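/- arXiv:1507.02476 — 2 statements merged into one kernel-verified Lean document; each statement's English description precedes it below -/
import Mathlib

section
/- (Unirationality of smooth cubic threefolds.) Let F ∈ ℂ[X₀,X₁,X₂,X₃,X₄] be a homogeneous polynomial of degree 3 such that the only common zero in ℂ⁵ of the partial derivatives ∂F/∂X₀,…,∂F/∂X₄ is the origin. Then the field of fractions K of ℂ[x₁,x₂,x₃,x₄]/(F(1,x₁,x₂,x₃,x₄)) admits a ℂ-algebra embedding into the rational function field ℂ(t₁,t₂,t₃). -/
open MvPolynomial

/-- The rational function field `ℂ(t₁,…,tₘ)`, realized as the field of fractions of the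
polynomial ring over `ℂ` in `m` variables. -/
abbrev CRatFunc (m : ℕ) : Type := FractionRing (MvPolynomial (Fin m) ℂ)

/-- A `ℂ`-algebra `K` is purely transcendental over `ℂ` if it is isomorphic as a `ℂ`-algebra
to `ℂ(t₁,…,tₘ)` for some `m ≥ 0`. -/
def IsPurelyTranscendental (K : Type*) [CommRing K] [Algebra ℂ K] : Prop :=
  ∃ m : ℕ, Nonempty (K ≃ₐ[ℂ] CRatFunc m)

/-- A `ℂ`-algebra `K` is unirational over `ℂ` if it admits a `ℂ`-algebra embedding into
`ℂ(t₁,…,tₘ)` for some `m`. -/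
def IsUnirational (K : Type*) [CommRing K] [Algebra ℂ K] : Prop :=
  ∃ (m : ℕ) (f : K →ₐ[ℂ] CRatFunc m), Function.Injective f

/-- A field `K` over `ℂ` is stably rational over `ℂ` if `K(u₁,…,uₙ)` is purely transcendental
over `ℂ` for some `n ≥ 0`. -/
def IsStablyRational (K : Type*) [Field K] [Algebra ℂ K] : Prop :=
  ∃ n : ℕ, IsPurelyTranscendental (FractionRing (MvPolynomial (Fin n) K))

/-- Dehomogenization at `X₀ = 1`: the image of `F ∈ ℂ[X₀,…,Xₙ]` under `X₀ ↦ 1`,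
`X_{i+1} ↦ xᵢ`. -/
noncomputable def dehom {n : ℕ} (F : MvPolynomial (Fin (n + 1)) ℂ) : MvPolynomial (Fin n) ℂ :=
  aeval (Fin.cases 1 X) F

namespace CubicUni

noncomputable def phi {R : Type*} [CommRing R] [Algebra ℂ R] (T : Fin 5 → Fin 5 → Fin 5 → ℂ)
    (x y z : Fin 5 → R) : R :=
  ∑ i, ∑ j, ∑ k, algebraMap ℂ R (T i j k) * x i * y j * z k

def TSym (T : Fin 5 → Fin 5 → Fin 5 → ℂ) : Prop :=
  ∀ i j k, T i j k = T j i k ∧ T i j k = T i k j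

section
variable {R : Type*} [CommRing R] [Algebra ℂ R] {T : Fin 5 → Fin 5 → Fin 5 → ℂ}

lemma phi_add1 (x x' y z : Fin 5 → R) : phi T (x + x') y z = phi T x y z + phi T x' y z := by
  simp only [phi, ← Finset.sum_add_distrib, Pi.add_apply]
  refine Finset.sum_congr rfl fun i _ => Finset.sum_congr rfl fun j _ =>
    Finset.sum_congr rfl fun k _ => by ring

lemma phi_add2 (x y y' z : Fin 5 → R) : phi T x (y + y') z = phi T x y z + phi T x y' z := by
  simp only [phi, ← Finset.sum_add_distrib, Pi.add_apply]
  refine Finset.sum_congr rfl fun i _ => Finset.sum_congr rfl fun j _ =>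
    Finset.sum_congr rfl fun k _ => by ring

lemma phi_add3 (x y z z' : Fin 5 → R) : phi T x y (z + z') = phi T x y z + phi T x y z' := by
  simp only [phi, ← Finset.sum_add_distrib, Pi.add_apply]
  refine Finset.sum_congr rfl fun i _ => Finset.sum_congr rfl fun j _ =>
    Finset.sum_congr rfl fun k _ => by ring

lemma phi_smul1 (c : R) (x y z : Fin 5 → R) : phi T (c • x) y z = c * phi T x y z := by
  simp only [phi, Finset.mul_sum, Pi.smul_apply, smul_eq_mul]
  refine Finset.sum_congr rfl fun i _ => Finset.sum_congr rfl fun j _ =>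
    Finset.sum_congr rfl fun k _ => by ring

lemma phi_smul2 (c : R) (x y z : Fin 5 → R) : phi T x (c • y) z = c * phi T x y z := by
  simp only [phi, Finset.mul_sum, Pi.smul_apply, smul_eq_mul]
  refine Finset.sum_congr rfl fun i _ => Finset.sum_congr rfl fun j _ =>
    Finset.sum_congr rfl fun k _ => by ring

lemma phi_smul3 (c : R) (x y z : Fin 5 → R) : phi T x y (c • z) = c * phi T x y z := by
  simp only [phi, Finset.mul_sum, Pi.smul_apply, smul_eq_mul]
  refine Finset.sum_congr rfl fun i _ => Finset.sum_congr rfl fun j _ =>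
    Finset.sum_congr rfl fun k _ => by ring

lemma phi_swap12 (hT : TSym T) (x y z : Fin 5 → R) : phi T x y z = phi T y x z := by
  simp only [phi]
  rw [Finset.sum_comm]
  refine Finset.sum_congr rfl fun i _ => Finset.sum_congr rfl fun j _ =>
    Finset.sum_congr rfl fun k _ => ?_
  rw [(hT j i k).1]; ring

lemma phi_swap23 (hT : TSym T) (x y z : Fin 5 → R) : phi T x y z = phi T x z y := by
  simp only [phi]
  refine Finset.sum_congr rfl fun i _ => ?_
  rw [Finset.sum_comm]
  refine Finset.sum_congr rfl fun j _ =>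
    Finset.sum_congr rfl fun k _ => ?_
  rw [(hT i k j).2]; ring

lemma phi_map {S : Type*} [CommRing S] [Algebra ℂ S] (f : R →ₐ[ℂ] S) (x y z : Fin 5 → R) :
    phi T (fun i => f (x i)) (fun i => f (y i)) (fun i => f (z i)) = f (phi T x y z) := by
  simp [phi]

lemma phi_zero3 (x y : Fin 5 → R) : phi T x y 0 = 0 := by simp [phi]

/-- The linear functional `phi T x y`. -/
noncomputable def phiL (T : Fin 5 → Fin 5 → Fin 5 → ℂ) (x y : Fin 5 → ℂ) :
    (Fin 5 → ℂ) →ₗ[ℂ] ℂ where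
  toFun := phi T x y
  map_add' := phi_add3 x y
  map_smul' c z := by simp [phi_smul3]

lemma phiL_apply (x y z : Fin 5 → ℂ) : phiL T x y z = phi T x y z := rfl

end

lemma pderiv_comm' (i j : Fin 5) (F : MvPolynomial (Fin 5) ℂ) :
    pderiv i (pderiv j F) = pderiv j (pderiv i F) := by
  have : ⁅(pderiv i : Derivation ℂ (MvPolynomial (Fin 5) ℂ) (MvPolynomial (Fin 5) ℂ)),
      (pderiv j : Derivation ℂ (MvPolynomial (Fin 5) ℂ) (MvPolynomial (Fin 5) ℂ))⁆ = 0 := by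
    apply MvPolynomial.derivation_ext
    intro k
    simp only [Derivation.commutator_apply, pderiv_X, Derivation.coe_zero, Pi.zero_apply]
    simp only [Pi.single_apply]
    split_ifs <;> simp
  have h := congrArg (fun D => D F) this
  simpa [Derivation.commutator_apply, sub_eq_zero] using h

lemma exists_tensor (F : MvPolynomial (Fin 5) ℂ) (hdeg : F.IsHomogeneous 3) :
    ∃ T, TSym T ∧ (∀ (R : Type) [CommRing R] [Algebra ℂ R] (x : Fin 5 → R),
      aeval x F = phi T x x x) ∧
      ∀ (v : Fin 5 → ℂ) i, eval v (pderiv i F) = 3 * phi T v v (Pi.single i 1) := by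
  have h3 : ∀ i j k, pderiv k (pderiv j (pderiv i F)) =
      C (coeff 0 (pderiv k (pderiv j (pderiv i F)))) := by
    intro i j k
    have : (pderiv k (pderiv j (pderiv i F))).IsHomogeneous 0 :=
      ((hdeg.pderiv (i := i)).pderiv (i := j)).pderiv (i := k)
    exact totalDegree_eq_zero_iff_eq_C.1 (Nat.le_zero.1 this.totalDegree_le)
  have e1 := hdeg.sum_X_mul_pderiv
  have e2 : ∀ i, ∑ j, X j * pderiv j (pderiv i F) = 2 • pderiv i F := fun i =>
    (hdeg.pderiv (i := i)).sum_X_mul_pderiv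
  have e3 : ∀ i j, ∑ k, X k * pderiv k (pderiv j (pderiv i F)) = pderiv j (pderiv i F) := by
    intro i j
    simpa using ((hdeg.pderiv (i := i)).pderiv (i := j)).sum_X_mul_pderiv
  set T : Fin 5 → Fin 5 → Fin 5 → ℂ :=
    fun i j k => coeff 0 (pderiv k (pderiv j (pderiv i F))) / 6 with hTdef
  have hT : TSym T := by
    intro i j k
    simp only [hTdef]
    constructor
    · rw [pderiv_comm' j i]
    · rw [pderiv_comm' k j]
  have h3' : ∀ i j k, pderiv k (pderiv j (pderiv i F)) = C (6 * T i j k) := by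
    intro i j k
    rw [h3]; congr 1; simp only [hTdef]; ring
  have d1 : ∀ i, 2 • pderiv i F = ∑ j, X j * ∑ k, X k * C (6 * T i j k) := by
    intro i
    rw [← e2]
    refine Finset.sum_congr rfl fun j _ => ?_
    rw [← e3 i j]
    simp only [h3']
  refine ⟨T, hT, ?_, ?_⟩
  · intro R _ _ x
    have : (6 : MvPolynomial (Fin 5) ℂ) * F =
        ∑ i, X i * ∑ j, X j * ∑ k, X k * C (6 * T i j k) := by
      calc (6 : MvPolynomial (Fin 5) ℂ) * F = 2 • (3 • F) := by simp only [nsmul_eq_mul]; push_cast; ring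
        _ = _ := by
          rw [← e1, Finset.smul_sum]
          refine Finset.sum_congr rfl fun i _ => ?_
          rw [← d1]; simp only [nsmul_eq_mul]; push_cast; ring
    have h6 := congrArg (aeval x) this
    simp only [map_mul, map_sum, aeval_X, aeval_C] at h6
    have hu : (algebraMap ℂ R 6) * aeval x F = algebraMap ℂ R 6 * phi T x x x := by
      have e6 : algebraMap ℂ R 6 = aeval x (6 : MvPolynomial (Fin 5) ℂ) := by
        rw [map_ofNat, map_ofNat]
      rw [e6, h6, ← e6]
      simp only [phi, Finset.mul_sum]
      refine Finset.sum_congr rfl fun i _ => Finset.sum_congr rfl fun j _ =>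
        Finset.sum_congr rfl fun k _ => ?_
      ring
    have := congrArg (fun t => algebraMap ℂ R (1/6) * t) hu
    simp only [← mul_assoc, ← map_mul] at this
    norm_num at this
    exact this
  · intro v i
    have h := congrArg (eval v) (d1 i)
    simp only [map_sum, map_mul, eval_X, eval_C, nsmul_eq_mul, map_natCast] at h
    have h2 : 2 * eval v (pderiv i F) = 6 * phi T v v (Pi.single i 1) := by
      have : phi T v v (Pi.single i 1) = phi T (Pi.single i 1) v v := by
        rw [phi_swap23 hT, phi_swap12 hT]
      rw [this]
      simp only [phi, Finset.mul_sum]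
      rw [Finset.sum_eq_single i]
      · refine Eq.trans (by simpa using h) ?_
        simp only [Finset.mul_sum]
        refine Finset.sum_congr rfl fun j _ => Finset.sum_congr rfl fun k _ => ?_
        simp
        ring
      · intro b _ hb
        simp [hb]
      · simp
    linear_combination h2 / 2

lemma exists_root_sum {k : Type*} [Field k] [IsAlgClosed k] (n : ℕ) (hn : n ≠ 0) (c : ℕ → k)
    (hc : c n ≠ 0) : ∃ s, ∑ i ∈ Finset.range (n + 1), c i * s ^ i = 0 := by
  set p : Polynomial k := ∑ i ∈ Finset.range (n + 1), Polynomial.C (c i) * Polynomial.X ^ i with hp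
  have hcoef : p.coeff n = c n := by
    simp [hp, Polynomial.finsetSum_coeff, Polynomial.coeff_C_mul, Polynomial.coeff_X_pow]
  have hd : p.degree ≠ 0 := by
    intro h
    have h2 := Polynomial.coeff_eq_zero_of_degree_lt (p := p) (n := n)
      (by rw [h]; exact_mod_cast Nat.pos_of_ne_zero hn)
    exact hc (hcoef ▸ h2)
  obtain ⟨s, hs⟩ := IsAlgClosed.exists_root p hd
  refine ⟨s, ?_⟩
  simpa [Polynomial.IsRoot, hp, Polynomial.eval_finsetSum] using hs

section
variable {R : Type*} [CommRing R] [Algebra ℂ R] {T : Fin 5 → Fin 5 → Fin 5 → ℂ}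

lemma phi_cube_add (hT : TSym T) (x y : Fin 5 → R) : phi T (x + y) (x + y) (x + y) =
    phi T x x x + 3 * phi T x x y + 3 * phi T x y y + phi T y y y := by
  simp only [phi_add1, phi_add2, phi_add3, phi_swap12 hT y x, fun z => phi_swap23 hT z y x]
  ring

lemma phi_sq_add (hT : TSym T) (p x y : Fin 5 → R) : phi T p (x + y) (x + y) =
    phi T p x x + 2 * phi T p x y + phi T p y y := by
  simp only [phi_add2, phi_add3, fun z => phi_swap23 hT z y x]
  ring

lemma phi_cube3 (hT : TSym T) (x y z : Fin 5 → R) :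
    phi T (x + y + z) (x + y + z) (x + y + z) =
    phi T x x x + 3 * phi T x x y + 3 * phi T x y y + phi T y y y + 3 * phi T x x z
      + 6 * phi T x y z + 3 * phi T y y z + 3 * phi T x z z + 3 * phi T y z z + phi T z z z := by
  simp only [phi_add1, phi_add2, phi_add3, phi_swap12 hT y x, fun z => phi_swap23 hT z y x,
    phi_swap12 hT z x, fun w => phi_swap23 hT w z x, phi_swap12 hT z y,
    fun w => phi_swap23 hT w z y]
  ring
end

section
variable {T : Fin 5 → Fin 5 → Fin 5 → ℂ}

lemma quad_zero (hT : TSym T) (p a b : Fin 5 → ℂ) : ∃ s t : ℂ, (s ≠ 0 ∨ t ≠ 0) ∧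
    phi T p (s • a + t • b) (s • a + t • b) = 0 := by
  by_cases h : phi T p a a = 0
  · exact ⟨1, 0, by simp, by simpa using h⟩
  · obtain ⟨s, hs⟩ := exists_root_sum 2 (by norm_num)
      (fun i => match i with
        | 0 => phi T p b b
        | 1 => 2 * phi T p a b
        | _ => phi T p a a) h
    refine ⟨s, 1, by simp, ?_⟩
    simp only [Finset.sum_range_succ, Finset.sum_range_zero] at hs
    rw [phi_sq_add hT]
    simp only [phi_smul2, phi_smul3]
    linear_combination hs

lemma cubic_zero (hT : TSym T) (a b : Fin 5 → ℂ) : ∃ s t : ℂ, (s ≠ 0 ∨ t ≠ 0) ∧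
    phi T (s • a + t • b) (s • a + t • b) (s • a + t • b) = 0 := by
  by_cases h : phi T a a a = 0
  · exact ⟨1, 0, by simp, by simpa using h⟩
  · obtain ⟨s, hs⟩ := exists_root_sum 3 (by norm_num)
      (fun i => match i with
        | 0 => phi T b b b
        | 1 => 3 * phi T a b b
        | 2 => 3 * phi T a a b
        | _ => phi T a a a) h
    refine ⟨s, 1, by simp, ?_⟩
    simp only [Finset.sum_range_succ, Finset.sum_range_zero] at hs
    rw [phi_cube_add hT]
    simp only [phi_smul1, phi_smul2, phi_smul3]
    linear_combination hs

lemma sextic_zero (hT : TSym T) (g2 g1 g0 : Fin 5 → ℂ) (h : phi T g2 g2 g2 ≠ 0) : ∃ s : ℂ,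
    phi T (s ^ 2 • g2 + s • g1 + g0) (s ^ 2 • g2 + s • g1 + g0) (s ^ 2 • g2 + s • g1 + g0) = 0 := by
  obtain ⟨s, hs⟩ := exists_root_sum 6 (by norm_num)
      (fun i => match i with
        | 0 => phi T g0 g0 g0
        | 1 => 3 * phi T g1 g0 g0
        | 2 => 3 * phi T g2 g0 g0 + 3 * phi T g1 g1 g0
        | 3 => 6 * phi T g2 g1 g0 + phi T g1 g1 g1
        | 4 => 3 * phi T g2 g2 g0 + 3 * phi T g2 g1 g1
        | 5 => 3 * phi T g2 g2 g1
        | _ => phi T g2 g2 g2) h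
  refine ⟨s, ?_⟩
  simp only [Finset.sum_range_succ, Finset.sum_range_zero] at hs
  rw [phi_cube3 hT]
  simp only [phi_smul1, phi_smul2, phi_smul3]
  linear_combination hs

/-- The conic-cubic intersection. -/
lemma conic_cubic (hT : TSym T) (p q a b : Fin 5 → ℂ) (hq : phi T p q q = 0)
    : ∃ x y z : ℂ, (x ≠ 0 ∨ y ≠ 0 ∨ z ≠ 0) ∧
      phi T p (x • q + y • a + z • b) (x • q + y • a + z • b) = 0 ∧
      phi T (x • q + y • a + z • b) (x • q + y • a + z • b) (x • q + y • a + z • b) = 0 := by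
  by_cases hdeg : ∃ s t : ℂ, (s ≠ 0 ∨ t ≠ 0) ∧
      phi T p (s • a + t • b) (s • a + t • b) = 0 ∧ phi T p q (s • a + t • b) = 0
  · obtain ⟨s, t, hst, h1, h2⟩ := hdeg
    obtain ⟨m, n, hmn, h3⟩ := cubic_zero hT q (s • a + t • b)
    have e : m • q + (n * s) • a + (n * t) • b = m • q + n • (s • a + t • b) := by module
    refine ⟨m, n * s, n * t, ?_, ?_, ?_⟩
    · by_cases hn : n = 0
      · left; simpa [hn] using hmn
      · right; simpa [hn] using hst
    · rw [e, phi_sq_add hT]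
      simp only [phi_smul2, phi_smul3, h1, h2, hq]; ring
    · rw [e, h3]
  push Not at hdeg
  have key : ∀ w, phi T p (phi T p w w • q + (-2 * phi T p q w) • w)
      (phi T p w w • q + (-2 * phi T p q w) • w) = 0 := by
    intro w
    rw [phi_sq_add hT]
    simp only [phi_smul2, phi_smul3, hq]; ring
  obtain ⟨s, t, hst, h6⟩ : ∃ s t : ℂ, (s ≠ 0 ∨ t ≠ 0) ∧ ∀ v, v = (phi T p (s • a + t • b) (s • a + t • b)
      • q + (-2 * phi T p q (s • a + t • b)) • (s • a + t • b)) → phi T v v v = 0 := by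
    by_cases h : phi T (phi T p a a • q + (-2 * phi T p q a) • a)
        (phi T p a a • q + (-2 * phi T p q a) • a) (phi T p a a • q + (-2 * phi T p q a) • a) = 0
    · refine ⟨1, 0, by simp, ?_⟩
      rintro v rfl
      simpa using h
    · obtain ⟨s, hs⟩ := sextic_zero hT _ ((2 * phi T p a b) • q + (-2 * phi T p q a) • b
        + (-2 * phi T p q b) • a) (phi T p b b • q + (-2 * phi T p q b) • b) h
      refine ⟨s, 1, by simp, ?_⟩
      rintro v rfl
      convert hs using 1
      have : (phi T p (s • a + (1:ℂ) • b) (s • a + (1:ℂ) • b) • q + (-2 * phi T p q (s • a + (1:ℂ) • b)) • (s • a + (1:ℂ) • b))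
        = (s ^ 2 • (phi T p a a • q + (-2 * phi T p q a) • a) +
            s • ((2 * phi T p a b) • q + (-2 * phi T p q a) • b + (-2 * phi T p q b) • a) +
          (phi T p b b • q + (-2 * phi T p q b) • b)) := by
        rw [phi_sq_add hT]
        simp only [phi_smul2, phi_smul3, phi_add3]
        module
      rw [this]
  have hz := hdeg s t hst
  have hk := key (s • a + t • b)
  set w := s • a + t • b with hw
  refine ⟨phi T p w w, (-2 * phi T p q w) * s, (-2 * phi T p q w) * t, ?_, ?_⟩
  · by_cases h : phi T p w w = 0
    · right
      have := hz h
      simpa [this] using hst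
    · exact Or.inl h
  · have e : phi T p w w • q + ((-2 * phi T p q w) * s) • a + ((-2 * phi T p q w) * t) • b =
      phi T p w w • q + (-2 * phi T p q w) • w := by rw [hw]; module
    rw [e]
    exact ⟨hk, h6 _ rfl⟩

lemma exists_line (hT : TSym T) : ∃ a b : Fin 5 → ℂ, LinearIndependent ℂ ![a, b] ∧
    phi T a a a = 0 ∧ phi T a a b = 0 ∧ phi T a b b = 0 ∧ phi T b b b = 0 := by
  obtain ⟨p, hp0, hp⟩ : ∃ p : Fin 5 → ℂ, p ≠ 0 ∧ phi T p p p = 0 := by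
    obtain ⟨s, t, hst, h⟩ := cubic_zero hT (Pi.single 0 1) (Pi.single 1 1)
    refine ⟨_, ?_, h⟩
    intro h0
    have h1 := congrFun h0 0
    have h2 := congrFun h0 1
    simp at h1 h2
    tauto
  set W := LinearMap.ker (phiL T p p) with hW
  have hWr : 4 ≤ Module.finrank ℂ W := by
    have h1 := LinearMap.finrank_range_add_finrank_ker (phiL T p p)
    have h2 := Submodule.finrank_le (LinearMap.range (phiL T p p))
    simp at h1 h2
    rw [hW]
    omega
  have hmem : ∀ v : W, phi T p p v = 0 := fun v => v.2
  let p' : W := ⟨p, hp⟩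
  have l1 : LinearIndependent ℂ ![p'] := by
    rw [linearIndependent_unique_iff]
    simpa [p', Subtype.ext_iff] using hp0
  obtain ⟨d1, l2⟩ := exists_linearIndependent_cons_of_lt_finrank l1 (by omega)
  obtain ⟨d2, l3⟩ := exists_linearIndependent_cons_of_lt_finrank l2 (by omega)
  obtain ⟨s, t, hst, hq⟩ := quad_zero hT p d1 d2
  let q : W := s • d1 + t • d2
  have m2 : LinearIndependent ℂ ![q, p'] := by
    rw [LinearIndependent.pair_iff]
    intro u v huv
    rw [Fintype.linearIndependent_iff] at l3
    have := l3 ![u * t, u * s, v] (by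
      simp only [Fin.sum_univ_succ, Finset.univ_eq_empty, Finset.sum_empty]
      simp
      rw [← huv]; simp only [q]; module)
    have h0 := this 0
    have h1 := this 1
    have h2 := this 2
    simp at h0 h1 h2
    refine ⟨?_, h2⟩
    tauto
  obtain ⟨a, m3⟩ := exists_linearIndependent_cons_of_lt_finrank m2 (by omega)
  obtain ⟨b, m4⟩ := exists_linearIndependent_cons_of_lt_finrank m3 (by omega)
  obtain ⟨x, y, z, hxyz, h1, h2⟩ := conic_cubic hT p q a b hq
  let r : W := x • q + y • a + z • b
  have m5 : LinearIndependent ℂ ![p', r] := by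
    rw [LinearIndependent.pair_iff]
    intro u v huv
    rw [Fintype.linearIndependent_iff] at m4
    have := m4 ![v * z, v * y, v * x, u] (by
      simp only [Fin.sum_univ_succ, Finset.univ_eq_empty, Finset.sum_empty]
      simp
      rw [← huv]; simp only [r]; module)
    have h0 := this 0
    have h1 := this 1
    have h2 := this 2
    have h3 := this 3
    simp at h0 h1 h2 h3
    refine ⟨h3, ?_⟩
    tauto
  refine ⟨p, r, ?_, hp, hmem r, h1, h2⟩
  have := m5.map' W.subtype (Submodule.ker_subtype W)
  have e : ![p, (r : Fin 5 → ℂ)] = W.subtype ∘ ![p', r] := by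
    ext i j
    fin_cases i <;> rfl
  rw [e]
  exact this

/-- A smooth cubic contains no hyperplane. -/
lemma no_hyperplane (hT : TSym T) (hsm : ∀ v : Fin 5 → ℂ, (∀ y, phi T v v y = 0) → v = 0)
    (l : (Fin 5 → ℂ) →ₗ[ℂ] ℂ) (hv : ∀ x, l x = 0 → phi T x x x = 0) : False := by
  have hpol1 : ∀ x y, l x = 0 → l y = 0 → phi T x x y = 0 := by
    intro x y hx hy
    have h1 := hv (x + y) (by simp [hx, hy])
    have h2 := hv (x + (-1 : ℂ) • y) (by simp [hx, hy])
    have h3 := hv x hx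
    have h4 := hv y hy
    rw [phi_cube_add hT] at h1 h2
    simp only [phi_smul1, phi_smul2, phi_smul3] at h2
    linear_combination (h1 - h2 - 2 * h4) / 6
  have hWr : 4 ≤ Module.finrank ℂ (LinearMap.ker l) := by
    have h1 := LinearMap.finrank_range_add_finrank_ker l
    have h2 := Submodule.finrank_le (LinearMap.range l)
    simp at h1 h2
    omega
  have hind : ∃ a b : LinearMap.ker l, LinearIndependent ℂ ![a, b] := by
    obtain ⟨a, ha⟩ := Module.finrank_pos_iff_exists_ne_zero.1 (show 0 < Module.finrank ℂ (LinearMap.ker l) by omega)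
    obtain ⟨b, h⟩ := exists_linearIndependent_pair_of_one_lt_finrank (R := ℂ) (by omega) ha
    exact ⟨a, b, h⟩
  obtain ⟨a, b, hab⟩ := hind
  rw [LinearIndependent.pair_iff] at hab
  by_cases hl : ∃ n, l n = 1
  · obtain ⟨n, hn⟩ := hl
    obtain ⟨s, t, hst, hq⟩ := quad_zero hT n a b
    have hw : l (s • (a : Fin 5 → ℂ) + t • b) = 0 := (s • a + t • b).2
    have h0 := hsm (s • (a : Fin 5 → ℂ) + t • b) (by
      intro y
      have e : y = l y • n + (y - l y • n) := by abel
      rw [e, phi_add3, phi_smul3, hpol1 _ (y - l y • n) hw (by simp [hn]), phi_swap23 hT,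
        phi_swap12 hT, hq]
      simp)
    have := hab s t (Subtype.ext (by simpa using h0))
    tauto
  · have hl0 : ∀ x, l x = 0 := by
      intro x
      by_contra hx
      exact hl ⟨(l x)⁻¹ • x, by simp [hx]⟩
    have := hsm a (fun y => hpol1 a y (hl0 _) (hl0 _))
    have h1 := hab 1 0 (Subtype.ext (by simpa using this))
    simp at h1

end

section
variable {L : Type*} [Field L] [Algebra ℂ L] {T : Fin 5 → Fin 5 → Fin 5 → ℂ}

def io (L : Type*) [Field L] [Algebra ℂ L] (v : Fin 5 → ℂ) : Fin 5 → L :=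
  fun i => algebraMap ℂ L (v i)

lemma phi_io (u v w : Fin 5 → ℂ) : phi T (io L u) (io L v) (io L w) =
    algebraMap ℂ L (phi T u v w) := by
  exact phi_map (T := T) (Algebra.ofId ℂ L) u v w

lemma phi_mem (E : IntermediateField ℂ L) (u v w : Fin 5 → L) (hu : ∀ i, u i ∈ E)
    (hv : ∀ i, v i ∈ E) (hw : ∀ i, w i ∈ E) : phi T u v w ∈ E := by
  unfold phi
  refine sum_mem fun i _ => sum_mem fun j _ => sum_mem fun k _ => ?_
  exact mul_mem (mul_mem (mul_mem (E.algebraMap_mem _) (hu i)) (hv j)) (hw k)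

lemma quad_indep (s : L) (hs : ∀ σ : ℂ, algebraMap ℂ L σ ≠ s) (α β δ : ℂ)
    (h : algebraMap ℂ L α + algebraMap ℂ L β * s + algebraMap ℂ L δ * s ^ 2 = 0) :
    α = 0 ∧ β = 0 ∧ δ = 0 := by
  set p : Polynomial ℂ := Polynomial.C α + Polynomial.C β * Polynomial.X +
    Polynomial.C δ * Polynomial.X ^ 2 with hp
  have hp0 : p = 0 := by
    by_contra hne
    have halg : IsAlgebraic ℂ s := ⟨p, hne, by simpa [hp] using h⟩
    have h1 := IsAlgClosed.degree_eq_one_of_irreducible ℂ (minpoly.irreducible halg.isIntegral)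
    obtain ⟨σ, hσ⟩ := minpoly.mem_range_of_degree_eq_one ℂ s h1
    exact hs σ hσ
  have h0 := congrArg (fun q => Polynomial.coeff q 0) hp0
  have h1 := congrArg (fun q => Polynomial.coeff q 1) hp0
  have h2 := congrArg (fun q => Polynomial.coeff q 2) hp0
  simp [hp, Polynomial.coeff_X, Polynomial.coeff_C, Polynomial.coeff_X_pow] at h0 h1 h2
  exact ⟨h0, h1, h2⟩

lemma coords (x : Fin 5 → L) (hx : ∀ l : Fin 5 → ℂ, ∑ i, algebraMap ℂ L (l i) * x i = 0 → l = 0)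
    (v : Fin 5 → (Fin 5 → ℂ)) (hv : LinearIndependent ℂ v) :
    ∃ y : Fin 5 → L, (∀ i, x i = ∑ m, y m * algebraMap ℂ L (v m i)) ∧
      ∀ l : Fin 5 → ℂ, ∑ m, algebraMap ℂ L (l m) * y m = 0 → l = 0 := by
  let B := basisOfLinearIndependentOfCardEqFinrank hv (by simp)
  have hB : ∀ m, B m = v m := fun m => by simp [B]
  refine ⟨fun m => ∑ i, algebraMap ℂ L (B.repr (Pi.single i 1) m) * x i, ?_, ?_⟩
  · intro i
    simp only [Finset.sum_mul]
    rw [Finset.sum_comm]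
    rw [Finset.sum_eq_single i]
    · have h := congrFun (B.sum_repr (Pi.single i 1)) i
      simp only [Finset.sum_apply, Pi.smul_apply, smul_eq_mul, hB, Pi.single_eq_same] at h
      calc x i = algebraMap ℂ L 1 * x i := by simp
        _ = _ := by
          have h' := congrArg (fun t => algebraMap ℂ L t * x i) h
          simp only [map_sum, Finset.sum_mul] at h'
          rw [← h']
          refine Finset.sum_congr rfl fun m _ => ?_
          rw [map_mul]; ring
    · intro j _ hj
      have h := congrFun (B.sum_repr (Pi.single j 1)) i
      simp only [Finset.sum_apply, Pi.smul_apply, smul_eq_mul, hB] at h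
      rw [Pi.single_eq_of_ne hj.symm] at h
      calc _ = algebraMap ℂ L (∑ m, B.repr (Pi.single j 1) m * v m i) * x j := by
            rw [map_sum, Finset.sum_mul]
            refine Finset.sum_congr rfl fun m _ => ?_
            rw [map_mul]; ring
        _ = 0 := by rw [h]; simp
    · simp
  · intro l hl
    have h2 := hx (fun i => ∑ m, l m * B.repr (Pi.single i 1) m) (by
      rw [← hl]
      simp only [Finset.mul_sum, map_sum, Finset.sum_mul, map_mul]
      rw [Finset.sum_comm]
      refine Finset.sum_congr rfl fun m _ => Finset.sum_congr rfl fun i _ => by ring)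
    let f : (Fin 5 → ℂ) →ₗ[ℂ] ℂ := ∑ m, l m • B.coord m
    have hf : f = 0 := by
      apply LinearMap.pi_ext'
      intro i
      ext
      simpa [f] using congrFun h2 i
    ext m
    have h3 := congrArg (fun g => g (B m)) hf
    simpa [f, Finsupp.single_apply] using h3

lemma core [IsAlgClosed L] (hT : TSym T) (hsm : ∀ v : Fin 5 → ℂ, (∀ y, phi T v v y = 0) → v = 0)
    (x : Fin 5 → L) (hx0 : x 0 = 1)
    (hx : ∀ l : Fin 5 → ℂ, ∑ i, algebraMap ℂ L (l i) * x i = 0 → l = 0)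
    (hF : phi T x x x = 0) :
    ∃ e : Fin 3 → L, ∀ i, x i ∈ IntermediateField.adjoin ℂ (Set.range e) := by
  obtain ⟨a, b, hab, haaa, haab, habb, hbbb⟩ := exists_line hT
  have hab' := LinearIndependent.pair_iff.1 hab
  obtain ⟨c2, hc2⟩ : ∃ c2, phi T b b c2 ≠ 0 := by
    by_contra h
    push Not at h
    have := hab' 0 1 (by simp [hsm b h])
    simp at this
  have l3 : LinearIndependent ℂ (Fin.cons c2 ![a, b] : Fin 3 → (Fin 5 → ℂ)) := by
    refine LinearIndependent.finCons hab ?_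
    intro hm
    simp only [Matrix.range_cons, Matrix.range_empty, Set.union_empty, Set.singleton_union] at hm
    obtain ⟨m, n, h⟩ := Submodule.mem_span_pair.1 hm
    apply hc2
    rw [← h, phi_add3, phi_smul3, phi_smul3, hbbb, phi_swap23 hT, phi_swap12 hT, habb]
    simp
  obtain ⟨c0, l4⟩ := exists_linearIndependent_cons_of_lt_finrank l3 (by simp)
  obtain ⟨c1, l5⟩ := exists_linearIndependent_cons_of_lt_finrank l4 (by simp)
  obtain ⟨y, hxy, hy⟩ := coords x hx _ l5
  -- any vector killed on the basis
  have hspan : ∀ σ : ℂ, phi T (a + σ • b) (a + σ • b) c0 = 0 →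
      phi T (a + σ • b) (a + σ • b) c1 = 0 → phi T (a + σ • b) (a + σ • b) c2 = 0 → False := by
    intro σ h0 h1 h2
    have hz := hsm (a + σ • b) (by
      let B := basisOfLinearIndependentOfCardEqFinrank l5 (by simp)
      have : phiL T (a + σ • b) (a + σ • b) = 0 := by
        apply B.ext
        intro i
        simp only [B, coe_basisOfLinearIndependentOfCardEqFinrank]
        have ha : phi T (a + σ • b) (a + σ • b) a = 0 := by
          rw [phi_swap23 hT, phi_swap12 hT, phi_sq_add hT]
          simp only [phi_smul2, phi_smul3, haaa, haab, habb]; ring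
        have hb : phi T (a + σ • b) (a + σ • b) b = 0 := by
          rw [phi_swap23 hT, phi_swap12 hT, phi_sq_add hT]
          simp only [phi_smul2, phi_smul3, hbbb, phi_swap12 hT b a, fun w => phi_swap23 hT w b a,
            haab, habb]; ring
        fin_cases i
        · exact h1
        · exact h0
        · exact h2
        · exact ha
        · exact hb
      intro y
      exact congrArg (fun g => g y) this)
    have := hab' 1 σ (by simpa using hz)
    simp at this
  simp only [Fin.sum_univ_five] at hxy hy
  set N := y 1 with hN
  have hN0 : N ≠ 0 := by
    intro h0
    have := congrFun (hy (Pi.single 1 1) (by simp [h0])) 1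
    simp at this
  set r := y 3 / N with hr
  set β := y 4 / N with hβ
  set u1 := y 0 / N with hu1
  set u2 := y 2 / N with hu2
  have hlin : ∀ k0 k1 k2 : ℂ, algebraMap ℂ L k0 + algebraMap ℂ L k1 * u1 + algebraMap ℂ L k2 * u2 = 0
      → k0 = 0 ∧ k1 = 0 ∧ k2 = 0 := by
    intro k0 k1 k2 h
    have h2 := hy ![k1, k0, k2, 0, 0] (by
      have e1 : y 0 = N * u1 := by rw [hu1]; field_simp
      have e2 : y 2 = N * u2 := by rw [hu2]; field_simp
      simp [e1, e2]
      linear_combination N * h)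
    have q0 := congrFun h2 0
    have q1 := congrFun h2 1
    have q2 := congrFun h2 2
    simp at q0 q1 q2
    exact ⟨q1, q0, q2⟩
  set w : Fin 5 → L := io L c0 + u1 • io L c1 + u2 • io L c2 with hw
  have hxP : x = N • (r • io L a + β • io L b + w) := by
    ext i
    rw [hxy i]
    simp [hw, io, hr, hβ, hu1, hu2]
    field_simp
    ring
  -- the tangency parameter
  have hphiw : ∀ u v : Fin 5 → ℂ, phi T (io L u) (io L v) w = algebraMap ℂ L (phi T u v c0) +
      algebraMap ℂ L (phi T u v c1) * u1 + algebraMap ℂ L (phi T u v c2) * u2 := by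
    intro u v
    rw [hw]
    simp only [phi_add3, phi_smul3, phi_io]; ring
  have hC : phi T (io L b) (io L b) w ≠ 0 := by
    intro h
    rw [hphiw] at h
    exact hc2 (hlin _ _ _ h).2.2
  obtain ⟨s, hs⟩ := exists_root_sum 2 (by norm_num)
      (fun i => match i with
        | 0 => phi T (io L a) (io L a) w
        | 1 => 2 * phi T (io L a) (io L b) w
        | _ => phi T (io L b) (io L b) w) hC
  simp only [Finset.sum_range_succ, Finset.sum_range_zero] at hs
  set g : Fin 5 → L := io L a + s • io L b with hg
  have hggw : phi T g g w = 0 := by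
    rw [hg, phi_swap23 hT, phi_swap12 hT, phi_sq_add hT]
    simp only [phi_smul2, phi_smul3]
    rw [phi_swap12 hT w, phi_swap23 hT _ w, phi_swap12 hT w, phi_swap23 hT _ w,
      phi_swap12 hT w, phi_swap23 hT _ w]
    linear_combination hs
  have hgg : ∀ c : Fin 5 → ℂ, phi T g g (io L c) = algebraMap ℂ L (phi T a a c) +
      algebraMap ℂ L (2 * phi T a b c) * s + algebraMap ℂ L (phi T b b c) * s ^ 2 := by
    intro c
    rw [hg]
    simp only [phi_add1, phi_add2, phi_smul1, phi_smul2, phi_io, phi_swap12 hT b a]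
    simp only [map_mul, map_ofNat]
    ring
  have hgb : ∀ c : Fin 5 → ℂ, phi T g (io L b) (io L c) = algebraMap ℂ L (phi T a b c) +
      algebraMap ℂ L (phi T b b c) * s := by
    intro c
    rw [hg]
    simp only [phi_add1, phi_smul1, phi_io]
    ring
  have hgexp : phi T g g (io L c0) + phi T g g (io L c1) * u1 + phi T g g (io L c2) * u2 = 0 := by
    rw [← hggw, hw]
    simp only [phi_add3, phi_smul3]; ring
  have hgbexp : phi T g (io L b) w = phi T g (io L b) (io L c0) + phi T g (io L b) (io L c1) * u1
      + phi T g (io L b) (io L c2) * u2 := by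
    rw [hw]
    simp only [phi_add3, phi_smul3]; ring
  have hσ : ∀ (σ : ℂ) (c : Fin 5 → ℂ), phi T (a + σ • b) (a + σ • b) c = phi T a a c
      + 2 * phi T a b c * σ + phi T b b c * σ ^ 2 := by
    intro σ c
    simp only [phi_add1, phi_add2, phi_smul1, phi_smul2, phi_swap12 hT b a]
    ring
  have hsC : ∀ σ : ℂ, algebraMap ℂ L σ ≠ s := by
    intro σ h
    simp only [hgg, ← h, ← map_mul, ← map_pow, ← map_add] at hgexp
    obtain ⟨h0, h1, h2⟩ := hlin _ _ _ hgexp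
    exact hspan σ (by rw [hσ, h0]) (by rw [hσ, h1]) (by rw [hσ, h2])
  have hg2 : phi T g g (io L c2) ≠ 0 := by
    intro h
    rw [hgg] at h
    exact hc2 (quad_indep s hsC _ _ _ h).2.2
  have hu2' : u2 = -(phi T g g (io L c0) + phi T g g (io L c1) * u1) / phi T g g (io L c2) := by
    rw [eq_div_iff hg2]
    linear_combination hgexp
  set z := β - r * s with hz
  have hP : r • io L a + β • io L b + w = r • g + z • io L b + w := by
    rw [hg, hz]; module
  have hmain : r * (6 * z * phi T g (io L b) w + 3 * phi T g w w) +
      (3 * z ^ 2 * phi T (io L b) (io L b) w + 3 * z * phi T (io L b) w w + phi T w w w) = 0 := by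
    have h := hF
    rw [hxP, hP] at h
    simp only [phi_smul1 N, phi_smul2 N, phi_smul3 N] at h
    have h' : phi T (r • g + z • io L b + w) (r • g + z • io L b + w) (r • g + z • io L b + w) = 0 := by
      simpa [hN0] using h
    rw [phi_cube3 hT] at h'
    simp only [phi_smul1, phi_smul2, phi_smul3] at h'
    have e1 : phi T g g (io L b) = 0 := by
      rw [hgg, phi_swap12 hT] ; simp [haab, habb, hbbb]
    have e2 : phi T g (io L b) (io L b) = 0 := by
      rw [hgb]; simp [habb, hbbb]
    have e3 : phi T g g g = 0 := by
      have : phi T g g g = phi T g g (io L a) + s * phi T g g (io L b) := by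
        conv_lhs => rw [hg, phi_add3, phi_smul3, ← hg]
      rw [this, e1, hgg, phi_swap23 hT a b a, phi_swap23 hT b b a, phi_swap12 hT b a b]
      simp [haaa, haab, habb]
    have e4 : phi T (io L b) (io L b) (io L b) = 0 := by rw [phi_io, hbbb]; simp
    rw [e1, e2, e3, e4, hggw] at h'
    linear_combination h'
  have hio : ∀ (E : IntermediateField ℂ L) (c : Fin 5 → ℂ) i, io L c i ∈ E :=
    fun E c i => E.algebraMap_mem _
  have hgE : ∀ E : IntermediateField ℂ L, s ∈ E → ∀ i, g i ∈ E := by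
    intro E hs i
    exact add_mem (hio E a i) (mul_mem hs (hio E b i))
  have hu2E : ∀ E : IntermediateField ℂ L, s ∈ E → u1 ∈ E → u2 ∈ E := by
    intro E hs h1
    rw [hu2']
    have hg' := hgE E hs
    exact div_mem (neg_mem (add_mem (phi_mem E _ _ _ hg' hg' (hio E _))
      (mul_mem (phi_mem E _ _ _ hg' hg' (hio E _)) h1))) (phi_mem E _ _ _ hg' hg' (hio E _))
  have hwE : ∀ E : IntermediateField ℂ L, s ∈ E → u1 ∈ E → ∀ i, w i ∈ E := by
    intro E hs h1 i
    exact add_mem (add_mem (hio E _ i) (mul_mem h1 (hio E _ i)))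
      (mul_mem (hu2E E hs h1) (hio E _ i))
  have hfin : ∀ E : IntermediateField ℂ L, s ∈ E → u1 ∈ E → z ∈ E → r ∈ E → ∀ i, x i ∈ E := by
    intro E hs h1 hz hr
    have hPE : ∀ i, (r • g + z • io L b + w) i ∈ E := fun i =>
      add_mem (add_mem (mul_mem hr (hgE E hs i)) (mul_mem hz (hio E _ i))) (hwE E hs h1 i)
    rw [hP] at hxP
    have hNE : N ∈ E := by
      have h0 := congrFun hxP 0
      rw [hx0, Pi.smul_apply, smul_eq_mul] at h0
      rw [eq_inv_of_mul_eq_one_left h0.symm]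
      exact inv_mem (hPE 0)
    intro i
    rw [congrFun hxP i]
    exact mul_mem hNE (hPE i)
  have hnum : ∀ (E : IntermediateField ℂ L) (n : ℕ), (n : L) ∈ E := fun E n => natCast_mem E n
  by_cases hQ : 6 * z * phi T g (io L b) w + 3 * phi T g w w = 0
  · by_cases hB : phi T g (io L b) w = 0
    · -- `u1` is redundant
      refine ⟨![s, z, r], ?_⟩
      set E := IntermediateField.adjoin ℂ (Set.range ![s, z, r])
      have hs' : s ∈ E := IntermediateField.subset_adjoin _ _ ⟨0, rfl⟩
      have hz' : z ∈ E := IntermediateField.subset_adjoin _ _ ⟨1, rfl⟩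
      have hr' : r ∈ E := IntermediateField.subset_adjoin _ _ ⟨2, rfl⟩
      refine hfin E hs' ?_ hz' hr'
      rw [hgbexp] at hB
      have hg' := hgE E hs'
      have m1 : ∀ c, phi T g g (io L c) ∈ E := fun c => phi_mem E _ _ _ hg' hg' (hio E _)
      have m2 : ∀ c, phi T g (io L b) (io L c) ∈ E := fun c =>
        phi_mem E _ _ _ hg' (hio E _) (hio E _)
      have hrel : u1 * (phi T g (io L b) (io L c1) * phi T g g (io L c2)
            - phi T g (io L b) (io L c2) * phi T g g (io L c1))
          = -(phi T g (io L b) (io L c0) * phi T g g (io L c2)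
            - phi T g (io L b) (io L c2) * phi T g g (io L c0)) := by
        linear_combination phi T g g (io L c2) * hB - phi T g (io L b) (io L c2) * hgexp
      by_cases hD : phi T g (io L b) (io L c1) * phi T g g (io L c2)
            - phi T g (io L b) (io L c2) * phi T g g (io L c1) = 0
      · exfalso
        have hD0 : phi T g (io L b) (io L c0) * phi T g g (io L c2)
            - phi T g (io L b) (io L c2) * phi T g g (io L c0) = 0 := by
          rw [hD] at hrel
          linear_combination hrel
        have hpar : ∀ c, phi T g (io L b) (io L c) * phi T g g (io L c2)
            - phi T g (io L b) (io L c2) * phi T g g (io L c) = 0 →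
            phi T b b c * phi T a a c2 = phi T b b c2 * phi T a a c ∧
            phi T b b c * phi T a b c2 = phi T b b c2 * phi T a b c := by
          intro c h
          have h2 := quad_indep s hsC
            (phi T a b c * phi T a a c2 - phi T a b c2 * phi T a a c)
            (phi T b b c * phi T a a c2 - phi T b b c2 * phi T a a c)
            (phi T b b c * phi T a b c2 - phi T b b c2 * phi T a b c) (by
              rw [← h]
              simp only [hgg, hgb]
              simp only [map_sub, map_mul, map_ofNat]
              ring)
          exact ⟨sub_eq_zero.1 h2.2.1, sub_eq_zero.1 h2.2.2⟩
        obtain ⟨σ, hσ0⟩ := exists_root_sum 2 (by norm_num)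
          (fun i => match i with
            | 0 => phi T a a c2
            | 1 => 2 * phi T a b c2
            | _ => phi T b b c2) hc2
        simp only [Finset.sum_range_succ, Finset.sum_range_zero] at hσ0
        have hall : ∀ c, phi T g (io L b) (io L c) * phi T g g (io L c2)
            - phi T g (io L b) (io L c2) * phi T g g (io L c) = 0 →
            phi T (a + σ • b) (a + σ • b) c = 0 := by
          intro c h
          obtain ⟨p1, p2⟩ := hpar c h
          rw [hσ]
          have : phi T b b c2 * (phi T a a c + 2 * phi T a b c * σ + phi T b b c * σ ^ 2) = 0 := by
            linear_combination phi T b b c * hσ0 - p1 - 2 * σ * p2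
          exact (mul_eq_zero.1 this).resolve_left hc2
        exact hspan σ (hall c0 hD0) (hall c1 hD) (hall c2 (by ring))
      · rw [(eq_div_iff hD).2 hrel]
        exact div_mem (neg_mem (sub_mem (mul_mem (m2 _) (m1 _)) (mul_mem (m2 _) (m1 _))))
          (sub_mem (mul_mem (m2 _) (m1 _)) (mul_mem (m2 _) (m1 _)))
    · -- `z` is redundant
      refine ⟨![s, u1, r], ?_⟩
      set E := IntermediateField.adjoin ℂ (Set.range ![s, u1, r])
      have hs' : s ∈ E := IntermediateField.subset_adjoin _ _ ⟨0, rfl⟩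
      have hu' : u1 ∈ E := IntermediateField.subset_adjoin _ _ ⟨1, rfl⟩
      have hr' : r ∈ E := IntermediateField.subset_adjoin _ _ ⟨2, rfl⟩
      refine hfin E hs' hu' ?_ hr'
      have hL : CharZero L := charZero_of_injective_algebraMap (algebraMap ℂ L).injective
      have e : z = -phi T g w w / ((2 : ℕ) * phi T g (io L b) w) := by
        rw [eq_div_iff (mul_ne_zero (by norm_num) hB)]
        push_cast
        linear_combination hQ / 3
      rw [e]
      have hg' := hgE E hs'
      have hw' := hwE E hs' hu'
      exact div_mem (neg_mem (phi_mem E _ _ _ hg' hw' hw'))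
        (mul_mem (hnum E 2) (phi_mem E _ _ _ hg' (hio E _) hw'))
  · refine ⟨![s, u1, z], ?_⟩
    set E := IntermediateField.adjoin ℂ (Set.range ![s, u1, z])
    have hs' : s ∈ E := IntermediateField.subset_adjoin _ _ ⟨0, rfl⟩
    have hu' : u1 ∈ E := IntermediateField.subset_adjoin _ _ ⟨1, rfl⟩
    have hz' : z ∈ E := IntermediateField.subset_adjoin _ _ ⟨2, rfl⟩
    refine hfin E hs' hu' hz' ?_
    have hg' := hgE E hs'
    have hw' := hwE E hs' hu'
    have hb' := hio E b
    have e : r = -(3 * z ^ 2 * phi T (io L b) (io L b) w + 3 * z * phi T (io L b) w w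
        + phi T w w w) / (6 * z * phi T g (io L b) w + 3 * phi T g w w) := by
      rw [eq_div_iff hQ]
      linear_combination hmain
    rw [e]
    have n3 : (3 : L) ∈ E := hnum E 3
    have n6 : (6 : L) ∈ E := hnum E 6
    exact div_mem (neg_mem (add_mem (add_mem (mul_mem (mul_mem n3 (pow_mem hz' 2))
      (phi_mem E _ _ _ hb' hb' hw')) (mul_mem (mul_mem n3 hz') (phi_mem E _ _ _ hb' hw' hw')))
      (phi_mem E _ _ _ hw' hw' hw'))) (add_mem (mul_mem (mul_mem n6 hz')
      (phi_mem E _ _ _ hg' hb' hw')) (mul_mem n3 (phi_mem E _ _ _ hg' hw' hw')))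

end

lemma affine_form (A : MvPolynomial (Fin 4) ℂ) (h : A.totalDegree ≤ 1) :
    ∃ (a0 : ℂ) (a : Fin 4 → ℂ), A = C a0 + ∑ i, C (a i) * X i := by
  have h1 := sum_homogeneousComponent A
  have hsub : ∑ i ∈ Finset.range 2, homogeneousComponent i A = A := by
    conv_rhs => rw [← h1]
    symm
    apply Finset.sum_subset
    · intro i; simp; omega
    · intro i _ hi
      apply homogeneousComponent_eq_zero
      simp at hi; omega
  simp only [Finset.sum_range_succ, Finset.sum_range_zero, zero_add, homogeneousComponent_zero] at hsub
  set B := homogeneousComponent 1 A with hB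
  have hBh : B.IsHomogeneous 1 := homogeneousComponent_isHomogeneous 1 A
  have he := hBh.sum_X_mul_pderiv
  have hc : ∀ i, pderiv i B = C (coeff 0 (pderiv i B)) := fun i => by
    have : (pderiv i B).IsHomogeneous 0 := hBh.pderiv (i := i)
    exact totalDegree_eq_zero_iff_eq_C.1 (Nat.le_zero.1 this.totalDegree_le)
  refine ⟨coeff 0 A, fun i => coeff 0 (pderiv i B), ?_⟩
  conv_lhs => rw [← hsub]
  congr 1
  rw [one_smul] at he
  conv_lhs => rw [← he]
  refine Finset.sum_congr rfl fun i _ => ?_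
  rw [← hc i, mul_comm]

section
variable {F : MvPolynomial (Fin 5) ℂ} {T : Fin 5 → Fin 5 → Fin 5 → ℂ}

lemma eval_dehom (hF : ∀ (R : Type) [CommRing R] [Algebra ℂ R] (x : Fin 5 → R),
      aeval x F = phi T x x x) (x : Fin 5 → ℂ) (hx : x 0 ≠ 0) :
    phi T x x x = x 0 ^ 3 * eval (fun i => x i.succ / x 0) (dehom F) := by
  have h1 : eval (fun i : Fin 4 => x i.succ / x 0) (dehom F) =
      aeval (fun i => x i / x 0) F := by
    rw [dehom, ← MvPolynomial.coe_aeval_eq_eval]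
    change aeval _ (aeval _ F) = _
    rw [MvPolynomial.comp_aeval_apply]
    congr 2
    ext i
    refine Fin.cases ?_ (fun i => ?_) i
    · simp [hx]
    · simp
  have h2 : x = x 0 • (fun i => x i / x 0) := by
    ext i; simp; field_simp
  rw [h1, hF]
  conv_lhs => rw [h2]
  simp only [phi_smul1, phi_smul2, phi_smul3]
  ring

lemma three_eq (hT : TSym T) (x y : Fin 5 → ℂ)
    (h : ∀ t : ℂ, t ≠ 0 → phi T (x + t • y) (x + t • y) (x + t • y) = t ^ 3 * phi T y y y) :
    phi T x x x = 0 := by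
  have h1 := h 1 (by norm_num)
  have h2 := h (-1) (by norm_num)
  have h3 := h 2 (by norm_num)
  rw [phi_cube_add hT] at h1 h2 h3
  simp only [phi_smul1, phi_smul2, phi_smul3] at h1 h2 h3
  linear_combination h1 + h2 / 3 - h3 / 3

lemma dehom_totalDegree_ne (hT : TSym T) (hsm : ∀ v : Fin 5 → ℂ, (∀ y, phi T v v y = 0) → v = 0)
    (hF : ∀ (R : Type) [CommRing R] [Algebra ℂ R] (x : Fin 5 → R),
      aeval x F = phi T x x x) : (dehom F).totalDegree ≠ 0 := by
  intro h
  rw [totalDegree_eq_zero_iff_eq_C] at h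
  have hv : ∀ x : Fin 5 → ℂ, x 0 ≠ 0 → phi T x x x = x 0 ^ 3 * coeff 0 (dehom F) := by
    intro x hx
    rw [eval_dehom hF x hx]
    conv_lhs => rw [h, eval_C]
  refine no_hyperplane hT hsm (LinearMap.proj 0) ?_
  intro x hx
  apply three_eq hT x (Pi.single 0 1)
  simp only [LinearMap.coe_proj, Function.eval] at hx
  intro t ht
  rw [hv _ (by simp [hx, ht]), hv _ (by simp)]
  simp [hx]

lemma dehom_no_linear (hT : TSym T) (hsm : ∀ v : Fin 5 → ℂ, (∀ y, phi T v v y = 0) → v = 0)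
    (hF : ∀ (R : Type) [CommRing R] [Algebra ℂ R] (x : Fin 5 → R),
      aeval x F = phi T x x x) (A : MvPolynomial (Fin 4) ℂ) (hA : A.totalDegree = 1)
    (hd : A ∣ dehom F) : False := by
  obtain ⟨a0, a, hAe⟩ := affine_form A hA.le
  have hj : ∃ j, a j ≠ 0 := by
    by_contra h
    push Not at h
    rw [hAe] at hA
    simp [h] at hA
  obtain ⟨j, hj⟩ := hj
  obtain ⟨B, hB⟩ := hd
  let l : (Fin 5 → ℂ) →ₗ[ℂ] ℂ := a0 • LinearMap.proj 0 + ∑ i : Fin 4, a i • LinearMap.proj i.succ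
  have hl : ∀ x, l x = a0 * x 0 + ∑ i : Fin 4, a i * x i.succ := by
    intro x; simp [l]
  have hv : ∀ x : Fin 5 → ℂ, x 0 ≠ 0 → l x = 0 → phi T x x x = 0 := by
    intro x hx hlx
    rw [eval_dehom hF x hx, hB, map_mul]
    have : eval (fun i : Fin 4 => x i.succ / x 0) A = 0 := by
      rw [hl] at hlx
      have e : eval (fun i : Fin 4 => x i.succ / x 0) A = (a0 * x 0 + ∑ i : Fin 4, a i * x i.succ) / x 0 := by
        rw [hAe]
        simp only [map_add, map_sum, map_mul, eval_C, eval_X]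
        rw [add_div, Finset.sum_div]
        congr 1
        · field_simp
        · refine Finset.sum_congr rfl fun i _ => by ring
      rw [e, hlx, zero_div]
    rw [this]; ring
  refine no_hyperplane hT hsm l ?_
  intro x hx
  by_cases h0 : x 0 = 0
  · let y : Fin 5 → ℂ := Pi.single 0 1 + (-a0 / a j) • Pi.single j.succ 1
    have hly : l y = 0 := by
      rw [hl]
      simp [y, Pi.single_apply, Fin.succ_ne_zero]
      field_simp
      ring
    have hy0 : y 0 = 1 := by simp [y, (Fin.succ_ne_zero j).symm]
    apply three_eq hT x y
    intro t ht
    rw [hv _ (by simp [h0, hy0, ht]) (by simp [hx, hly]), hv y (by simp [hy0]) hly]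
    ring
  · exact hv x h0 hx

lemma dehom_totalDegree_le (hdeg : F.IsHomogeneous 3) : (dehom F).totalDegree ≤ 3 := by
  rw [dehom, aeval_def, eval₂_eq']
  refine (totalDegree_finsetSum _ _).trans (Finset.sup_le fun d hd => ?_)
  refine (totalDegree_mul _ _).trans ?_
  have h1 : ((algebraMap ℂ (MvPolynomial (Fin 4) ℂ)) (coeff d F)).totalDegree = 0 := by
    rw [algebraMap_eq, totalDegree_C]
  rw [h1, zero_add]
  refine (totalDegree_finsetProd _ _).trans ?_
  have h3 : ∑ i, d i = 3 := by
    have := hdeg (mem_support_iff.1 hd)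
    rw [← this, Finsupp.weight_apply, Finsupp.sum_fintype] <;> simp
  rw [← h3]
  refine Finset.sum_le_sum fun i _ => ?_
  refine (totalDegree_pow _ _).trans ?_
  have : ((Fin.cases 1 X : Fin 5 → MvPolynomial (Fin 4) ℂ) i).totalDegree ≤ 1 := by
    refine Fin.cases ?_ (fun i => ?_) i
    · simp
    · simp
  calc _ ≤ d i * 1 := Nat.mul_le_mul_left _ this
    _ = d i := mul_one _

lemma dehom_irreducible (hdeg : F.IsHomogeneous 3) (hT : TSym T)
    (hsm : ∀ v : Fin 5 → ℂ, (∀ y, phi T v v y = 0) → v = 0)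
    (hF : ∀ (R : Type) [CommRing R] [Algebra ℂ R] (x : Fin 5 → R),
      aeval x F = phi T x x x) : Irreducible (dehom F) := by
  have h0 := dehom_totalDegree_ne hT hsm hF
  have hne : dehom F ≠ 0 := by rintro h; simp [h] at h0
  have hu : ∀ A : MvPolynomial (Fin 4) ℂ, A ≠ 0 → A.totalDegree = 0 → IsUnit A := by
    intro A hA h
    rw [totalDegree_eq_zero_iff_eq_C] at h
    rw [h]
    refine (IsUnit.mk0 _ ?_).map C
    intro hc
    rw [hc] at h
    simp at h
    exact hA h
  refine ⟨?_, ?_⟩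
  · intro h
    exact h0 (isUnit_iff_totalDegree_of_isReduced.1 h).2
  · intro A B hAB
    have hA : A ≠ 0 := by rintro rfl; simp [hAB] at hne
    have hB : B ≠ 0 := by rintro rfl; simp [hAB] at hne
    have hd := totalDegree_mul_of_isDomain hA hB
    rw [← hAB] at hd
    have h3 := dehom_totalDegree_le hdeg
    by_contra hcon
    push Not at hcon
    have hA0 : A.totalDegree ≠ 0 := fun h => hcon.1 (hu A hA h)
    have hB0 : B.totalDegree ≠ 0 := fun h => hcon.2 (hu B hB h)
    have : A.totalDegree = 1 ∨ B.totalDegree = 1 := by omega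
    rcases this with h | h
    · exact dehom_no_linear hT hsm hF A h ⟨B, hAB⟩
    · exact dehom_no_linear hT hsm hF B h ⟨A, by rw [hAB, mul_comm]⟩

lemma dehom_not_dvd_linear (hT : TSym T)
    (hsm : ∀ v : Fin 5 → ℂ, (∀ y, phi T v v y = 0) → v = 0)
    (hF : ∀ (R : Type) [CommRing R] [Algebra ℂ R] (x : Fin 5 → R),
      aeval x F = phi T x x x) (P : MvPolynomial (Fin 4) ℂ) (hP : P.totalDegree ≤ 1)
    (hd : dehom F ∣ P) : P = 0 := by
  by_contra hP0
  obtain ⟨B, hB⟩ := hd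
  have h0 := dehom_totalDegree_ne hT hsm hF
  have h1 := totalDegree_mul_of_isDomain (f := dehom F) (g := B)
    (by rintro h; simp [h] at h0) (by rintro rfl; simp at hB; exact hP0 hB)
  rw [← hB] at h1
  exact dehom_no_linear hT hsm hF (dehom F) (by omega) dvd_rfl

end

lemma algIndep_of_gen {L : Type} [Field L] [Algebra ℂ L] (e : Fin 3 → L) {ι : Type}
    (hι : Cardinal.mk ι = 3) (s : ι → L) (hs : AlgebraicIndependent ℂ s)
    (hse : ∀ i, s i ∈ IntermediateField.adjoin ℂ (Set.range e)) :
    AlgebraicIndependent ℂ e := by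
  set E := IntermediateField.adjoin ℂ (Set.range e) with hE
  let s' : ι → E := fun i => ⟨s i, hse i⟩
  have hs' : AlgebraicIndependent ℂ s' := by
    refine AlgebraicIndependent.of_comp E.val ?_
    exact hs
  let e' : Fin 3 → E := fun i => ⟨e i, IntermediateField.subset_adjoin _ _ ⟨i, rfl⟩⟩
  have hle := hs'.cardinalMk_le_trdeg
  rw [hι] at hle
  have halg : Algebra.IsAlgebraic (Algebra.adjoin ℂ (Set.range e')) E := by
    constructor
    intro y
    obtain ⟨r, t, hrt⟩ := (IntermediateField.mem_adjoin_range_iff ℂ e (y : L)).1 y.2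
    have hy' : y = aeval e' r / aeval e' t := by
      apply Subtype.ext
      have h1 : ∀ p : MvPolynomial (Fin 3) ℂ, ((aeval e' p : E) : L) = aeval e p := by
        intro p
        have := MvPolynomial.comp_aeval_apply (f := e') E.val p
        exact this
      rw [hrt]
      push_cast
      rw [h1, h1]
    have hm : ∀ p : MvPolynomial (Fin 3) ℂ,
        IsAlgebraic (Algebra.adjoin ℂ (Set.range e')) (aeval e' p : E) := by
      intro p
      have : aeval e' p ∈ Algebra.adjoin ℂ (Set.range e') := by
        rw [Algebra.adjoin_range_eq_range_aeval]; exact ⟨p, rfl⟩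
      exact isAlgebraic_algebraMap (⟨_, this⟩ : Algebra.adjoin ℂ (Set.range e'))
    rw [hy', div_eq_mul_inv]
    exact (hm r).mul (hm t).inv
  have := Algebra.IsAlgebraic.isTranscendenceBasis_of_le_trdeg_of_finite ℂ e' (by simpa using hle)
  exact this.1.map' (f := E.val) E.val.injective

lemma algIndep_quot {L : Type} [Field L] [Algebra ℂ L] (f : MvPolynomial (Fin 4) ℂ)
    (hf : f.totalDegree ≠ 0) (ψ : MvPolynomial (Fin 4) ℂ →ₐ[ℂ] L) (hψ : ∀ p, ψ p = 0 → f ∣ p) :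
    ∃ j : Fin 4, AlgebraicIndependent ℂ (fun i : {i : Fin 4 // i ≠ j} => ψ (X i.1)) := by
  have hj : ∃ j, degreeOf j f ≠ 0 := by
    by_contra h
    push Not at h
    apply hf
    rw [totalDegree_eq_zero_iff]
    intro m hm x
    have := monomial_le_degreeOf x hm
    rw [h x] at this
    omega
  obtain ⟨j, hj⟩ := hj
  refine ⟨j, ?_⟩
  rw [algebraicIndependent_iff]
  intro p hp
  have h1 : ψ (rename Subtype.val p) = 0 := by
    rw [← hp, ← MvPolynomial.comp_aeval_apply]
    conv_lhs => rw [← aeval_X_left_apply (rename Subtype.val p), aeval_rename]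
    rfl
  obtain ⟨q, hq⟩ := hψ _ h1
  by_contra hp0
  have hr0 : rename (Subtype.val : {i : Fin 4 // i ≠ j} → Fin 4) p ≠ 0 := by
    intro h
    exact hp0 (rename_injective _ Subtype.val_injective (by simpa using h))
  have hd : degreeOf j (rename (Subtype.val : {i : Fin 4 // i ≠ j} → Fin 4) p) = 0 := by
    by_contra h
    obtain ⟨i, -, hi⟩ := mem_vars_rename _ _ (mem_vars_iff_degreeOf_ne_zero.2 h)
    exact i.2 hi
  rw [hq] at hr0 hd
  rw [degreeOf_mul_eq (left_ne_zero_of_mul hr0) (right_ne_zero_of_mul hr0)] at hd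
  omega

lemma affine_eq_zero (l : Fin 5 → ℂ)
    (h : (∑ i, C (l i) * (Fin.cases 1 X : Fin 5 → MvPolynomial (Fin 4) ℂ) i) = 0) : l = 0 := by
  rw [Fin.sum_univ_succ] at h
  simp only [Fin.cases_zero, Fin.cases_succ, mul_one] at h
  have h0 : l 0 = 0 := by
    have := congrArg (eval (0 : Fin 4 → ℂ)) h
    simpa using this
  ext i
  refine Fin.cases h0 (fun j => ?_) i
  have := congrArg (eval (Pi.single j 1 : Fin 4 → ℂ)) h
  simpa [h0, Pi.single_apply] using this

lemma affine_deg (l : Fin 5 → ℂ) :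
    (∑ i, C (l i) * (Fin.cases 1 X : Fin 5 → MvPolynomial (Fin 4) ℂ) i).totalDegree ≤ 1 := by
  refine (totalDegree_finsetSum _ _).trans (Finset.sup_le fun i _ => ?_)
  refine (totalDegree_mul _ _).trans ?_
  rw [totalDegree_C, zero_add]
  refine Fin.cases ?_ (fun j => ?_) i
  · simp
  · simp

lemma main (F : MvPolynomial (Fin 5) ℂ)
    (hdeg : F.IsHomogeneous 3)
    (hsm : ∀ v : Fin 5 → ℂ, (∀ i, eval v (pderiv i F) = 0) → v = 0) :
    ∃ f : FractionRing (MvPolynomial (Fin 4) ℂ ⧸ (Ideal.span {dehom F})) →ₐ[ℂ] CRatFunc 3,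
      Function.Injective f := by
  obtain ⟨T, hT, hF, hp⟩ := exists_tensor F hdeg
  have hsm' : ∀ v : Fin 5 → ℂ, (∀ y, phi T v v y = 0) → v = 0 := by
    intro v hv
    refine hsm v fun i => ?_
    rw [hp, hv, mul_zero]
  have hirr := dehom_irreducible hdeg hT hsm' hF
  have htd := dehom_totalDegree_ne hT hsm' hF
  have hlin := dehom_not_dvd_linear hT hsm' hF
  have hdF : dehom F = aeval (Fin.cases 1 X : Fin 5 → MvPolynomial (Fin 4) ℂ) F := rfl
  generalize hf : dehom F = f at *
  have hI : (Ideal.span {f}).IsPrime :=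
    (Ideal.span_singleton_prime hirr.ne_zero).2 hirr.prime
  let R := MvPolynomial (Fin 4) ℂ ⧸ Ideal.span {f}
  let K := FractionRing R
  let L := AlgebraicClosure K
  let g : K →ₐ[ℂ] L := IsScalarTower.toAlgHom ℂ K L
  let ψ : MvPolynomial (Fin 4) ℂ →ₐ[ℂ] L :=
    g.comp ((IsScalarTower.toAlgHom ℂ R K).comp (Ideal.Quotient.mkₐ ℂ (Ideal.span {f})))
  have hψa : ∀ p, ψ p = g (algebraMap R K (Ideal.Quotient.mk _ p)) := fun p => rfl
  have hψ : ∀ p, ψ p = 0 ↔ f ∣ p := by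
    intro p
    rw [hψa, map_eq_zero_iff g g.injective,
      map_eq_zero_iff _ (IsFractionRing.injective R K), Ideal.Quotient.eq_zero_iff_mem,
      Ideal.mem_span_singleton]
  let x : Fin 5 → L := fun i => ψ ((Fin.cases 1 X : Fin 5 → MvPolynomial (Fin 4) ℂ) i)
  have hx0 : x 0 = 1 := by simp [x]
  have hFx : phi T x x x = 0 := by
    have h1 := phi_map (T := T) ψ (Fin.cases 1 X) (Fin.cases 1 X) (Fin.cases 1 X)
    refine h1.trans ?_
    rw [← hF, ← hdF, hψ]
  have hx : ∀ l : Fin 5 → ℂ, ∑ i, algebraMap ℂ L (l i) * x i = 0 → l = 0 := by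
    intro l hl
    apply affine_eq_zero
    apply hlin _ (affine_deg l)
    rw [← hψ, ← hl, map_sum]
    refine Finset.sum_congr rfl fun i _ => ?_
    rw [map_mul, ← algebraMap_eq, AlgHom.commutes]
  obtain ⟨e, he⟩ := core hT hsm' x hx0 hx hFx
  obtain ⟨j, hj⟩ := algIndep_quot f htd ψ (fun p => (hψ p).1)
  have hXe : ∀ i : Fin 4, ψ (X i) ∈ IntermediateField.adjoin ℂ (Set.range e) := fun i => he i.succ
  have hind : AlgebraicIndependent ℂ e := by
    refine algIndep_of_gen e ?_ _ hj (fun i => hXe i.1)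
    rw [Cardinal.mk_fintype]
    simp
  have hpe : ∀ p, ψ p ∈ IntermediateField.adjoin ℂ (Set.range e) := by
    intro p
    induction p using MvPolynomial.induction_on with
    | C a =>
      rw [← algebraMap_eq, AlgHom.commutes]
      exact IntermediateField.algebraMap_mem _ _
    | add p q hp hq => rw [map_add]; exact add_mem hp hq
    | mul_X p i hp => rw [map_mul]; exact mul_mem hp (hXe i)
  have hK : ∀ k : K, g k ∈ (IntermediateField.adjoin ℂ (Set.range e)).toSubalgebra := by
    intro k
    obtain ⟨a, b, -, rfl⟩ := IsFractionRing.div_surjective (A := R) k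
    obtain ⟨a, rfl⟩ := Ideal.Quotient.mk_surjective a
    obtain ⟨b, rfl⟩ := Ideal.Quotient.mk_surjective b
    rw [map_div₀]
    exact (IntermediateField.adjoin ℂ (Set.range e)).div_mem (hpe a) (hpe b)
  let h : K →ₐ[ℂ] IntermediateField.adjoin ℂ (Set.range e) := g.codRestrict _ hK
  refine ⟨(hind.aevalEquivField.symm : _ →ₐ[ℂ] CRatFunc 3).comp h, ?_⟩
  have hh : Function.Injective h := fun a b hab => g.injective (congrArg Subtype.val hab)
  exact hind.aevalEquivField.symm.injective.comp hh

end CubicUni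

/-- **Unirationality of smooth cubic threefolds.** If `F ∈ ℂ[X₀,…,X₄]` is homogeneous of
degree 3 and the only common zero of its partial derivatives is the origin, then the field
of fractions of `ℂ[x₁,…,x₄]/(F(1,x₁,…,x₄))` admits a `ℂ`-algebra embedding into
`ℂ(t₁,t₂,t₃)`. -/
theorem cubic_threefold_unirational (F : MvPolynomial (Fin 5) ℂ)
    (hdeg : F.IsHomogeneous 3)
    (hsm : ∀ v : Fin 5 → ℂ, (∀ i, eval v (pderiv i F) = 0) → v = 0) :
    ∃ f : FractionRing (MvPolynomial (Fin 4) ℂ ⧸ (Ideal.span {dehom F})) →ₐ[ℂ] CRatFunc 3,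
      Function.Injective f := by
  exact CubicUni.main F hdeg hsm
end

section
/- (Unirationality of smooth quartic double solids, field version.) Let F ∈ ℂ[X₀,X₁,X₂,X₃] be a homogeneous polynomial of degree 4 such that the only common zero in ℂ⁴ of the partial derivatives ∂F/∂X₀,…,∂F/∂X₃ is the origin. Then the field of fractions K of ℂ[x₁,x₂,x₃,w]/(w² − F(1,x₁,x₂,x₃)) admits a ℂ-algebra embedding into the rational function field ℂ(t₁,t₂,t₃). -/
open MvPolynomial

namespace QDS

/-- Relative algebraic closedness. -/
def RelClosed {L : Type} [Field L] [Algebra ℂ L] (K : IntermediateField ℂ L) : Prop :=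
  ∀ x : L, IsAlgebraic K x → x ∈ K

theorem algInd_of_closed (a : Fin 3 → CRatFunc 3)
    (H : ∀ K : IntermediateField ℂ (CRatFunc 3), RelClosed K → (∀ i, a i ∈ K) →
      ∀ i, algebraMap (MvPolynomial (Fin 3) ℂ) (CRatFunc 3) (X i) ∈ K) :
    AlgebraicIndependent ℂ a := by
  let K0 := IntermediateField.adjoin ℂ (Set.range a)
  let K1 : IntermediateField K0 (CRatFunc 3) := algebraicClosure K0 (CRatFunc 3)
  let K : IntermediateField ℂ (CRatFunc 3) := K1.restrictScalars ℂ
  have hKc : RelClosed K := by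
    intro x hx
    have h1 : IsAlgebraic K1 x := hx
    have : IsAlgebraic K0 x := by
      have : Algebra.IsAlgebraic K0 K1 := algebraicClosure.isAlgebraic K0 (CRatFunc 3)
      exact h1.restrictScalars K0
    exact mem_algebraicClosure_iff.2 this
  have haK : ∀ i, a i ∈ K := by
    intro i
    have h : a i ∈ K0 := IntermediateField.subset_adjoin _ _ ⟨i, rfl⟩
    exact K1.algebraMap_mem ⟨a i, h⟩
  have ht := H K hKc haK
  have htop : ∀ x : CRatFunc 3, x ∈ K := by
    intro x
    obtain ⟨p, q, hq, rfl⟩ := IsFractionRing.div_surjective (A := MvPolynomial (Fin 3) ℂ) x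
    have hp : ∀ p : MvPolynomial (Fin 3) ℂ, algebraMap _ (CRatFunc 3) p ∈ K := by
      intro p
      induction p using MvPolynomial.induction_on with
      | C c =>
        have := K.algebraMap_mem c
        rwa [IsScalarTower.algebraMap_apply ℂ (MvPolynomial (Fin 3) ℂ) (CRatFunc 3)] at this
      | add p q hp hq => rw [map_add]; exact K.add_mem hp hq
      | mul_X p i hp => rw [map_mul]; exact K.mul_mem hp (ht i)
    exact K.div_mem (hp p) (hp q)
  have halg : Algebra.IsAlgebraic K0 (CRatFunc 3) :=
    ⟨fun x => mem_algebraicClosure_iff.1 (htop x)⟩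
  have : Algebra.IsAlgebraic (Algebra.adjoin ℂ (Set.range a)) (CRatFunc 3) :=
    IntermediateField.isAlgebraic_adjoin_iff_top.1 halg
  have htr : Algebra.trdeg ℂ (CRatFunc 3) = 3 := by
    have hb : AlgebraicIndependent ℂ
      (fun i : Fin 3 => algebraMap (MvPolynomial (Fin 3) ℂ) (CRatFunc 3) (X i)) := by
      have := (MvPolynomial.algebraicIndependent_X (Fin 3) ℂ).map' (f := IsScalarTower.toAlgHom ℂ (MvPolynomial (Fin 3) ℂ) (CRatFunc 3)) (IsFractionRing.injective _ _)
      exact this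
    have hle := hb.cardinalMk_le_trdeg
    have hle2 := Algebra.IsAlgebraic.trdeg_le_cardinalMk (R := ℂ) (A := CRatFunc 3) (Set.range a)
    have h3 : Cardinal.mk (Set.range a) ≤ Cardinal.mk (Fin 3) := Cardinal.mk_range_le
    have h4 : Cardinal.mk (Fin 3) = 3 := by simp
    rw [h4] at hle h3
    exact le_antisymm (hle2.trans h3) hle
  exact (Algebra.IsAlgebraic.isTranscendenceBasis_of_le_trdeg_of_finite ℂ a (by simp [htr])).1


theorem rep_quot (f : MvPolynomial (Fin 3) ℂ) (p : MvPolynomial (Fin 4) ℂ) :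
    ∃ a b : MvPolynomial (Fin 3) ℂ,
      p - (rename Fin.castSucc a + rename Fin.castSucc b * X 3) ∈
        Ideal.span {(X 3 ^ 2 - rename Fin.castSucc f : MvPolynomial (Fin 4) ℂ)} := by
  induction p using MvPolynomial.induction_on with
  | C c => exact ⟨C c, 0, by simp⟩
  | add p q hp hq =>
    obtain ⟨a, b, h⟩ := hp
    obtain ⟨a', b', h'⟩ := hq
    refine ⟨a + a', b + b', ?_⟩
    have := Ideal.add_mem _ h h'
    convert this using 1
    simp only [map_add]; ring
  | mul_X p i hp =>
    obtain ⟨a, b, h⟩ := hp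
    induction i using Fin.lastCases with
    | last =>
      refine ⟨b * f, a, ?_⟩
      have h1 := Ideal.mul_mem_right (X 3) _ h
      have h2 := Ideal.mul_mem_left _ (rename Fin.castSucc b) (Ideal.subset_span (Set.mem_singleton (X 3 ^ 2 - rename Fin.castSucc f : MvPolynomial (Fin 4) ℂ)))
      have := Ideal.add_mem _ h1 h2
      convert this using 1
      have : (Fin.last 3) = (3 : Fin 4) := rfl
      simp only [map_mul, this]; ring
    | cast i =>
      refine ⟨a * X i, b * X i, ?_⟩
      have h1 := Ideal.mul_mem_right (X i.castSucc) _ h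
      convert h1 using 1
      simp only [map_mul, rename_X]; ring

theorem finish (F : MvPolynomial (Fin 4) ℂ)
    (hns : ∀ h : MvPolynomial (Fin 3) ℂ, dehom F ≠ h ^ 2)
    (a : Fin 3 → CRatFunc 3) (W : CRatFunc 3) (ha : AlgebraicIndependent ℂ a)
    (hW : aeval a (dehom F) = W ^ 2) :
    ∃ f : FractionRing (MvPolynomial (Fin 4) ℂ ⧸
        (Ideal.span {X 3 ^ 2 - rename Fin.castSucc (dehom F)})) →ₐ[ℂ] CRatFunc 3,
      Function.Injective f := by
  set f := dehom F with hf
  let I : Ideal (MvPolynomial (Fin 4) ℂ) := Ideal.span {X 3 ^ 2 - rename Fin.castSucc f}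
  let φ : MvPolynomial (Fin 4) ℂ →ₐ[ℂ] CRatFunc 3 := aeval (Fin.snoc (α := fun _ => CRatFunc 3) a W)
  have hφX : φ (X 3) = W := by
    change aeval _ _ = _
    rw [aeval_X]
    exact Fin.snoc_last (α := fun _ => CRatFunc 3) _ _
  have hφr : ∀ p, φ (rename Fin.castSucc p) = aeval a p := by
    intro p
    change aeval _ _ = _
    rw [aeval_rename]
    congr 1
    congr 1
    funext i
    exact Fin.snoc_castSucc (α := fun _ => CRatFunc 3) _ _ _
  have hker : ∀ p ∈ I, φ p = 0 := by
    intro p hp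
    obtain ⟨c, rfl⟩ := Ideal.mem_span_singleton'.1 hp
    rw [map_mul, map_sub, map_pow, hφX, hφr, hW]; ring
  let g : (MvPolynomial (Fin 4) ℂ ⧸ I) →ₐ[ℂ] CRatFunc 3 := Ideal.Quotient.liftₐ I φ hker
  have hg : Function.Injective g := by
    rw [injective_iff_map_eq_zero]
    intro x hx
    obtain ⟨p, rfl⟩ := Ideal.Quotient.mk_surjective x
    have hx' : φ p = 0 := hx
    obtain ⟨u, v, huv⟩ := rep_quot f p
    have h1 := hker _ huv
    rw [map_sub, hx', map_add, map_mul, hφX, hφr, hφr] at h1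
    have h2 : aeval a (u ^ 2) = aeval a (v ^ 2 * f) := by
      rw [map_pow, map_mul, map_pow, hW]
      linear_combination (aeval a v * W - aeval a u) * h1
    have h3 : u ^ 2 = v ^ 2 * f := ha h2
    have hv : v = 0 := by
      by_contra hv
      have hd : v ∣ u := by
        have : v ^ 2 ∣ u ^ 2 := ⟨f, h3⟩
        exact (UniqueFactorizationMonoid.pow_dvd_pow_iff_dvd two_ne_zero).1 this
      obtain ⟨k, rfl⟩ := hd
      apply hns k
      have : v ^ 2 ≠ 0 := pow_ne_zero _ hv
      apply mul_left_cancel₀ this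
      rw [← h3]; ring
    subst hv
    have hu : u = 0 := by simpa using h3
    subst hu
    rw [Ideal.Quotient.eq_zero_iff_mem]
    simpa using huv
  have : IsDomain (MvPolynomial (Fin 4) ℂ ⧸ I) := hg.isDomain g.toRingHom
  exact ⟨IsFractionRing.liftAlgHom (K := FractionRing (MvPolynomial (Fin 4) ℂ ⧸ I)) (g := g) hg, RingHom.injective (IsFractionRing.liftAlgHom (K := FractionRing (MvPolynomial (Fin 4) ℂ ⧸ I)) (g := g) hg).toRingHom⟩


section tay
variable {R S : Type} [CommRing R] [Algebra ℂ R] [CommRing S] [Algebra ℂ S]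

/-- Restriction of `F` to the line `P + λ d`. -/
noncomputable def tay (F : MvPolynomial (Fin 4) ℂ) (P d : Fin 4 → R) : Polynomial R :=
  aeval (fun i => Polynomial.C (P i) + Polynomial.X * Polynomial.C (d i)) F

theorem tay_map (F : MvPolynomial (Fin 4) ℂ) (P d : Fin 4 → R) (φ : R →ₐ[ℂ] S) :
    (tay F P d).map (φ : R →+* S) = tay F (fun i => φ (P i)) (fun i => φ (d i)) := by
  unfold tay
  rw [aeval_def]
  have h2 : ∀ p : Polynomial R, p.map (φ : R →+* S) = (Polynomial.mapAlgHom φ) p := fun p => rfl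
  rw [h2, ← aeval_def]
  rw [← AlgHom.comp_apply, comp_aeval]
  congr 2
  funext i
  simp

theorem tay_coeff_map (F : MvPolynomial (Fin 4) ℂ) (P d : Fin 4 → R) (φ : R →ₐ[ℂ] S) (k : ℕ) :
    φ ((tay F P d).coeff k) = (tay F (fun i => φ (P i)) (fun i => φ (d i))).coeff k := by
  rw [← tay_map, Polynomial.coeff_map]; rfl

theorem tay_eval (F : MvPolynomial (Fin 4) ℂ) (P d : Fin 4 → R) (c : R) :
    (tay F P d).eval c = aeval (fun i => P i + c * d i) F := by
  unfold tay
  have h2 : ∀ p : Polynomial R, p.eval c = ((Polynomial.aeval (R := R) c).restrictScalars ℂ) p := by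
    intro p; simp [Polynomial.aeval_def, Polynomial.eval₂_eq_eval_map]
  rw [h2, ← AlgHom.comp_apply, comp_aeval]
  congr 2
  funext i
  simp
  exact mul_comm _ _

theorem tay_scale (F : MvPolynomial (Fin 4) ℂ) (P d : Fin 4 → R) (c : R) (k : ℕ) :
    (tay F P (fun i => c * d i)).coeff k = c ^ k * (tay F P d).coeff k := by
  have : tay F P (fun i => c * d i) = (tay F P d).comp (Polynomial.C c * Polynomial.X) := by
    unfold tay
    have h2 : ∀ p : Polynomial R, p.comp (Polynomial.C c * Polynomial.X) =
      ((Polynomial.aeval (R := R) (Polynomial.C c * Polynomial.X)).restrictScalars ℂ) p := by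
      intro p; simp [Polynomial.aeval_def, Polynomial.comp]
    rw [h2, ← AlgHom.comp_apply, comp_aeval]
    congr 2
    funext i
    simp
    ring
  rw [this, Polynomial.comp_C_mul_X_coeff, mul_comm]

theorem tay_natDegree (F : MvPolynomial (Fin 4) ℂ) {n : ℕ} (hF : F.IsHomogeneous n) (P d : Fin 4 → R) :
    (tay F P d).natDegree ≤ n := by
  unfold tay
  rw [← aeval_map_algebraMap R]
  have := aeval_natDegree_le (n := 1) (map (algebraMap ℂ R) F) (hF.map (algebraMap ℂ R)).totalDegree_le
    (fun i => Polynomial.C (P i) + Polynomial.X * Polynomial.C (d i)) (by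
      intro i
      compute_degree)
  simpa using this

theorem tay_sum (F : MvPolynomial (Fin 4) ℂ) (hF : F.IsHomogeneous 4) (P d : Fin 4 → R) (c : R) :
    aeval (fun i => P i + c * d i) F = (tay F P d).coeff 0 + (tay F P d).coeff 1 * c
      + (tay F P d).coeff 2 * c ^ 2 + (tay F P d).coeff 3 * c ^ 3 + (tay F P d).coeff 4 * c ^ 4 := by
  rw [← tay_eval, Polynomial.eval_eq_sum_range' (Nat.lt_succ_of_le (tay_natDegree F hF P d))]
  simp [Finset.sum_range_succ]

theorem tay_deriv (F : MvPolynomial (Fin 4) ℂ) (P d : Fin 4 → R) :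
    Polynomial.derivative (tay F P d) = ∑ i, Polynomial.C (d i) * tay (pderiv i F) P d := by
  unfold tay
  induction F using MvPolynomial.induction_on with
  | C c =>
    have : (algebraMap ℂ (Polynomial R)) c = Polynomial.C (algebraMap ℂ R c) := rfl
    simp [this]
  | add p q hp hq => simp only [map_add, hp, hq, mul_add, Finset.sum_add_distrib]
  | mul_X p j hp =>
    set φ : MvPolynomial (Fin 4) ℂ →ₐ[ℂ] Polynomial R :=
      aeval (fun i => Polynomial.C (P i) + Polynomial.X * Polynomial.C (d i)) with hφ
    have e1 : Polynomial.derivative (φ (X j)) = Polynomial.C (d j) := by simp [hφ]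
    have e2 : ∀ i, φ (pderiv i (p * X j)) = φ p * (if i = j then 1 else 0) + φ (X j) * φ (pderiv i p) := by
      intro i
      rw [Derivation.leibniz, map_add, smul_eq_mul, smul_eq_mul, map_mul, map_mul, pderiv_X]
      by_cases h : i = j
      · subst h; simp
      · have h' : ¬ j = i := fun e => h e.symm
        simp [h, h']
    simp only [e2]
    rw [map_mul, Polynomial.derivative_mul, hp, e1]
    simp only [mul_add, Finset.sum_add_distrib, Finset.sum_mul]
    rw [add_comm]
    refine congrArg₂ (· + ·) ?_ ?_
    · rw [Finset.sum_eq_single j]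
      · rw [if_pos rfl]; ring
      · intro b _ hb; rw [if_neg hb]; ring
      · intro h; exact absurd (Finset.mem_univ j) h
    · apply Finset.sum_congr rfl
      intro i _
      ring

theorem tay_coeff_zero (F : MvPolynomial (Fin 4) ℂ) (P d : Fin 4 → R) :
    (tay F P d).coeff 0 = aeval P F := by
  rw [Polynomial.coeff_zero_eq_eval_zero, tay_eval]; simp

theorem tay_coeff_one (F : MvPolynomial (Fin 4) ℂ) (P d : Fin 4 → R) :
    (tay F P d).coeff 1 = ∑ i, d i * aeval P (pderiv i F) := by
  have := congrArg (fun p => Polynomial.coeff p 0) (tay_deriv F P d)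
  simp only [Polynomial.coeff_derivative, Polynomial.finsetSum_coeff, Polynomial.coeff_C_mul,
    tay_coeff_zero] at this
  simpa using this

theorem tay_coeff_two (F : MvPolynomial (Fin 4) ℂ) (P d : Fin 4 → R) :
    (tay F P d).coeff 2 * 2 = ∑ i, ∑ j, d i * d j * aeval P (pderiv j (pderiv i F)) := by
  have := congrArg (fun p => Polynomial.coeff p 1) (tay_deriv F P d)
  simp only [Polynomial.coeff_derivative, Polynomial.finsetSum_coeff, Polynomial.coeff_C_mul,
    tay_coeff_one, Finset.mul_sum] at this
  norm_num at this
  rw [this]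
  simp only [mul_assoc]

theorem pderiv_comm' (F : MvPolynomial (Fin 4) ℂ) (i j : Fin 4) :
    pderiv i (pderiv j F) = pderiv j (pderiv i F) := by
  have h : ⁅pderiv (R := ℂ) i, pderiv (R := ℂ) j⁆ = (0 : Derivation ℂ (MvPolynomial (Fin 4) ℂ) (MvPolynomial (Fin 4) ℂ)) := by
    apply MvPolynomial.derivation_ext
    intro k
    rw [Derivation.commutator_apply]
    simp [pderiv_X, Pi.single_apply, apply_ite]
  have := congrArg (fun D => D F) h
  simp only [Derivation.commutator_apply, Derivation.coe_zero, Pi.zero_apply] at this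
  exact sub_eq_zero.1 this

theorem hom_scale (F : MvPolynomial (Fin 4) ℂ) {n : ℕ} (hF : F.IsHomogeneous n) (P : Fin 4 → R) (c : R) :
    aeval (fun i => c * P i) F = c ^ n * aeval P F := by
  simp only [aeval_def, eval₂_eq, Finset.mul_sum]
  apply Finset.sum_congr rfl
  intro m hm
  have h := hF (mem_support_iff.1 hm)
  simp only [mul_pow, Finset.prod_mul_distrib, Finset.prod_pow_eq_pow_sum]
  have h' : ∑ i ∈ m.support, m i = n := by
    rw [← h, Finsupp.weight_apply, Finsupp.sum]; simp
  rw [h']; ring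

theorem euler_zero (F : MvPolynomial (Fin 4) ℂ) (hF : F.IsHomogeneous 4) (P : Fin 4 → R) :
    ∑ i, P i * aeval P (pderiv i F) = 4 * aeval P F := by
  have := congrArg (aeval P) hF.sum_X_mul_pderiv
  simpa using this
end tay


theorem dehom_not_sq (F : MvPolynomial (Fin 4) ℂ)
    (hdeg : F.IsHomogeneous 4)
    (hsm : ∀ v : Fin 4 → ℂ, (∀ i, eval v (pderiv i F) = 0) → v = 0)
    (h : MvPolynomial (Fin 3) ℂ) : dehom F ≠ h ^ 2 := by
  intro hF
  have key : ∀ (R : Type) [CommRing R] [Algebra ℂ R] (x : Fin 3 → R),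
      aeval (Fin.cases 1 x : Fin 4 → R) F = (aeval x h) ^ 2 := by
    intro R _ _ x
    rw [← map_pow, ← hF]
    unfold dehom
    rw [← AlgHom.comp_apply, comp_aeval]
    congr 2
    funext i
    refine Fin.cases ?_ (fun i => ?_) i <;> simp
  by_cases hz : ∃ x : Fin 3 → ℂ, aeval x h = 0
  · obtain ⟨x, hx⟩ := hz
    let v : Fin 4 → ℂ := Fin.cases 1 x
    have hv0 : aeval v F = 0 := by rw [key ℂ x, hx]; ring
    have hs : ∀ i : Fin 3, aeval v (pderiv i.succ F) = 0 := by
      intro i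
      have h1 := tay_coeff_one F v (Pi.single i.succ 1)
      have h2 : tay F v (Pi.single i.succ 1) =
        (aeval (fun k => Polynomial.C (x k) + Polynomial.X * Polynomial.C ((Pi.single i 1 : Fin 3 → ℂ) k)) h) ^ 2 := by
        rw [← key]
        unfold tay
        congr 2
        funext k
        refine Fin.cases ?_ (fun k => ?_) k
        · simp [v]
        · simp [v, Pi.single_apply, Fin.succ_inj]
      have h3 : (aeval (fun k => Polynomial.C (x k) + Polynomial.X * Polynomial.C ((Pi.single i 1 : Fin 3 → ℂ) k)) h).coeff 0 = 0 := by
        rw [← hx, Polynomial.coeff_zero_eq_eval_zero, ← Polynomial.coe_aeval_eq_eval,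
          ← AlgHom.comp_apply, comp_aeval]
        congr 2
        funext k
        simp
      rw [h2, pow_two, Polynomial.mul_coeff_one, h3] at h1
      simpa [Pi.single_apply, eq_comm] using h1
    have h0 := euler_zero F hdeg v
    rw [Fin.sum_univ_succ] at h0
    simp only [hs, hv0, mul_zero, Finset.sum_const_zero, add_zero] at h0
    have h0' : aeval v (pderiv 0 F) = 0 := by simpa [v] using h0
    have := hsm v (by
      intro i
      rw [← coe_aeval_eq_eval]
      refine Fin.cases h0' hs i)
    have := congrFun this 0
    simp [v] at this
  · push Not at hz
    obtain ⟨c, hc⟩ : ∃ c, h = C c := by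
      have hu : IsUnit h := by
        by_contra hu
        obtain ⟨I, hI, hIh⟩ := exists_max_ideal_of_mem_nonunits hu
        obtain ⟨x, hx⟩ := (MvPolynomial.isMaximal_iff_eq_vanishingIdeal_singleton (K := ℂ) (I := I)).1 hI
        rw [hx, mem_vanishingIdeal_singleton_iff] at hIh
        exact hz x hIh
      obtain ⟨c, hc, h⟩ := MvPolynomial.isUnit_iff_eq_C_of_isReduced.1 hu
      exact ⟨c, h⟩
    have hconst : ∀ x : Fin 3 → ℂ, aeval (Fin.cases 1 x : Fin 4 → ℂ) F = c ^ 2 := by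
      intro x; rw [key, hc]; simp
    -- F = c^2 X_0^4
    have hFe : F = C (c ^ 2) * X 0 ^ 4 := by
      have hp : X 0 * (F - C (c ^ 2) * X 0 ^ 4) = 0 := by
        apply MvPolynomial.funext
        intro v
        by_cases h0 : v 0 = 0
        · simp [h0]
        · have h1 := hom_scale F hdeg (Fin.cases 1 (fun i => v i.succ / v 0) : Fin 4 → ℂ) (v 0)
          rw [hconst] at h1
          have h2 : (fun i => v 0 * (Fin.cases 1 (fun i => v i.succ / v 0) : Fin 4 → ℂ) i) = v := by
            funext i
            refine Fin.cases ?_ (fun i => ?_) i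
            · simp
            · simp; field_simp
          rw [h2] at h1
          have h3 : eval v F = v 0 ^ 4 * c ^ 2 := by rw [← h1, ← coe_aeval_eq_eval]; rfl
          simp [h3]; right; ring
      rcases mul_eq_zero.1 hp with h | h
      · exact absurd h (X_ne_zero 0)
      · exact sub_eq_zero.1 h
    have := hsm (Pi.single 1 1) (by
      intro i
      rw [hFe]
      simp [Derivation.leibniz, pderiv_X])
    have := congrFun this 1
    simp at this


theorem reduce (F : MvPolynomial (Fin 4) ℂ)
    (hdeg : F.IsHomogeneous 4)
    (hsm : ∀ v : Fin 4 → ℂ, (∀ i, eval v (pderiv i F) = 0) → v = 0)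
    (p e1 e3 e4 : Fin 4 → ℂ) (hli : LinearIndependent ℂ ![p, e1, e3, e4])
    (x z u W : CRatFunc 3)
    (hW : aeval (fun i => algebraMap ℂ (CRatFunc 3) (p i) + x * algebraMap ℂ (CRatFunc 3) (e1 i)
      + z * algebraMap ℂ (CRatFunc 3) (e3 i) + u * algebraMap ℂ (CRatFunc 3) (e4 i)) F = W ^ 2)
    (H : ∀ K : IntermediateField ℂ (CRatFunc 3), RelClosed K → x ∈ K → z ∈ K → u ∈ K →
      ∀ i, algebraMap (MvPolynomial (Fin 3) ℂ) (CRatFunc 3) (X i) ∈ K) :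
    ∃ f : FractionRing (MvPolynomial (Fin 4) ℂ ⧸
        (Ideal.span {X 3 ^ 2 - rename Fin.castSucc (dehom F)})) →ₐ[ℂ] CRatFunc 3,
      Function.Injective f := by
  set ι := algebraMap ℂ (CRatFunc 3) with hι
  let M : Matrix (Fin 4) (Fin 4) ℂ := Matrix.of ![p, e1, e3, e4]
  have hu : IsUnit M := Matrix.linearIndependent_rows_iff_isUnit.1 hli
  obtain ⟨N, hMN, hNM⟩ : ∃ N, M * N = 1 ∧ N * M = 1 := by
    obtain ⟨U, hU⟩ := hu
    exact ⟨(U⁻¹ : (Matrix (Fin 4) (Fin 4) ℂ)ˣ), by rw [← hU]; simp, by rw [← hU]; simp⟩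
  let c : Fin 4 → CRatFunc 3 := ![1, x, z, u]
  set ξ : Fin 4 → CRatFunc 3 := fun i => ι (p i) + x * ι (e1 i) + z * ι (e3 i) + u * ι (e4 i) with hξ
  have hξc : ∀ j, ξ j = ∑ i, c i * ι (M i j) := by
    intro j
    rw [Fin.sum_univ_four]
    simp [c, M, hξ]
  have hcξ : ∀ k, c k = ∑ j, ξ j * ι (N j k) := by
    intro k
    simp only [hξc, Finset.sum_mul]
    rw [Finset.sum_comm]
    have : ∀ i, ∑ j, c i * ι (M i j) * ι (N j k) = c i * ι ((M * N) i k) := by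
      intro i
      rw [Matrix.mul_apply, map_sum, Finset.mul_sum]
      apply Finset.sum_congr rfl
      intro j _
      rw [map_mul]; ring
    simp only [this, hMN, Matrix.one_apply]
    rw [Finset.sum_eq_single k]
    · simp
    · intro b _ hb; simp [hb]
    · simp
  have hind : AlgebraicIndependent ℂ ![x, z, u] :=
    algInd_of_closed _ (fun K hK h => H K hK (h 0) (h 1) (h 2))
  have hξ0 : ξ 0 ≠ 0 := by
    intro h0
    have h1 : aeval ![x, z, u] (C (p 0) + X 0 * C (e1 0) + X 1 * C (e3 0) + X 2 * C (e4 0) : MvPolynomial (Fin 3) ℂ) = 0 := by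
      rw [← h0]
      simp [hξ, hι]
    have h2 : (C (p 0) + X 0 * C (e1 0) + X 1 * C (e3 0) + X 2 * C (e4 0) : MvPolynomial (Fin 3) ℂ) = 0 :=
      hind (by rw [h1, map_zero])
    have hp := congrArg (eval ![0, 0, 0]) h2
    have hq := congrArg (eval ![1, 0, 0]) h2
    have hr := congrArg (eval ![0, 1, 0]) h2
    have hs := congrArg (eval ![0, 0, 1]) h2
    simp at hp
    simp [hp] at hq hr hs
    have := congrFun (congrFun hNM 0) 0
    rw [Matrix.mul_apply, Fin.sum_univ_four] at this
    simp [M, hp, hq, hr, hs] at this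
  have hsc : ξ = fun i => ξ 0 * (Fin.cases 1 (fun i : Fin 3 => ξ i.succ / ξ 0) : Fin 4 → CRatFunc 3) i := by
    funext i
    refine Fin.cases ?_ (fun i => ?_) i
    · simp
    · simp only [Fin.cases_succ]; field_simp
  have hsq : aeval (fun i : Fin 3 => ξ i.succ / ξ 0) (dehom F) = (W / (ξ 0) ^ 2) ^ 2 := by
    have h1 : aeval (fun i : Fin 3 => ξ i.succ / ξ 0) (dehom F) =
        aeval (Fin.cases 1 (fun i : Fin 3 => ξ i.succ / ξ 0) : Fin 4 → CRatFunc 3) F := by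
      unfold dehom
      rw [← AlgHom.comp_apply, comp_aeval]
      congr 2
      funext i
      refine Fin.cases ?_ (fun i => ?_) i <;> simp
    rw [hsc, hom_scale F hdeg] at hW
    rw [h1, div_pow, ← hW]
    field_simp
  refine finish F (dehom_not_sq F hdeg hsm) (fun i : Fin 3 => ξ i.succ / ξ 0) _
    (algInd_of_closed _ ?_) hsq
  intro K hK ha
  have hη : ∀ j, ξ j / ξ 0 ∈ K := by
    intro j
    refine Fin.cases ?_ (fun i => ha i) j
    rw [div_self hξ0]; exact K.one_mem
  have hck : ∀ k, c k / ξ 0 ∈ K := by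
    intro k
    rw [hcξ, Finset.sum_div]
    apply K.sum_mem
    intro j _
    have : ξ j * ι (N j k) / ξ 0 = (ξ j / ξ 0) * ι (N j k) := by ring
    rw [this]
    exact K.mul_mem (hη j) (K.algebraMap_mem _)
  have h0 : ξ 0 ∈ K := by
    have := K.inv_mem (hck 0)
    simpa [c] using this
  have hc : ∀ k, c k ∈ K := by
    intro k
    have := K.mul_mem (hck k) h0
    rwa [div_mul_cancel₀ _ hξ0] at this
  exact H K hK (hc 1) (hc 2) (hc 3)


theorem tay_base_coeff (F : MvPolynomial (Fin 4) ℂ) (R : Type) [CommRing R] [Algebra ℂ R]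
    (p d : Fin 4 → ℂ) (k : ℕ) :
    (tay F (fun i => algebraMap ℂ R (p i)) (fun i => algebraMap ℂ R (d i))).coeff k
      = algebraMap ℂ R ((tay F p d).coeff k) := by
  have := tay_coeff_map F p d (Algebra.ofId ℂ R) k
  exact this.symm

theorem aeval_base (G : MvPolynomial (Fin 4) ℂ) (R : Type) [CommRing R] [Algebra ℂ R]
    (p : Fin 4 → ℂ) : aeval (fun i => algebraMap ℂ R (p i)) G = algebraMap ℂ R (aeval p G) := by
  have h : (Algebra.ofId ℂ R) (aeval p G) = aeval (fun i => Algebra.ofId ℂ R (p i)) G := by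
    rw [← AlgHom.comp_apply, comp_aeval]
  exact h.symm

theorem root_mem {L : Type} [Field L] [Algebra ℂ L] (K : IntermediateField ℂ L) (hK : RelClosed K)
    (E : Polynomial K) (hE : E ≠ 0) (s : L) (h : Polynomial.aeval s E = 0) : s ∈ K :=
  hK s ⟨E, hE, h⟩

theorem aeval_mem {L : Type} [Field L] [Algebra ℂ L] (K : IntermediateField ℂ L)
    (F : MvPolynomial (Fin 4) ℂ) (v : Fin 4 → L) (hv : ∀ i, v i ∈ K) : aeval v F ∈ K := by
  have h : K.val (aeval (fun i => (⟨v i, hv i⟩ : K)) F) = aeval v F := by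
    rw [← AlgHom.comp_apply, comp_aeval]
    rfl
  rw [← h]
  exact (aeval (fun i => (⟨v i, hv i⟩ : K)) F).2

theorem sq_mem {L : Type} [Field L] [Algebra ℂ L] (K : IntermediateField ℂ L) (hK : RelClosed K)
    (W : L) (h : W ^ 2 ∈ K) : W ∈ K := by
  refine root_mem K hK (Polynomial.X ^ 2 - Polynomial.C ⟨W ^ 2, h⟩) ?_ W ?_
  · exact Polynomial.X_pow_sub_C_ne_zero two_pos _
  · simp [IntermediateField.algebraMap_apply]

theorem caseII_s {L : Type} [Field L] [Algebra ℂ L] (F : MvPolynomial (Fin 4) ℂ)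
    (p e1 e3 e4 : Fin 4 → ℂ) (e f δ : ℂ) (hδ : δ ≠ 0)
    (hlin : ∀ (R : Type) [CommRing R] [Algebra ℂ R] (a b c : R),
      (tay F (fun i => algebraMap ℂ R (p i)) (fun i => a * algebraMap ℂ R (e1 i)
        + b * algebraMap ℂ R (e3 i) + c * algebraMap ℂ R (e4 i))).coeff 1 = b * algebraMap ℂ R δ)
    (K : IntermediateField ℂ L) (hK : RelClosed K) (s : L) (x z u W : K) (hz : z ≠ 0)
    (D : ℕ → L)
    (hD : ∀ k, D k = (tay F (fun i => algebraMap ℂ L (p i) + s * algebraMap ℂ L (e1 i))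
      (fun i => ((x : L) - s) * algebraMap ℂ L (e1 i) + z * algebraMap ℂ L (e3 i)
        + u * algebraMap ℂ L (e4 i))).coeff k)
    (q : L) (hq : q = algebraMap ℂ L e * s + algebraMap ℂ L f * s ^ 2)
    (hE : 8 * q ^ 4 - 8 * q ^ 3 * W + 4 * q ^ 2 * D 1 + 4 * q ^ 2 * D 2 - D 1 ^ 2 = 0) : s ∈ K := by
  obtain ⟨A, hA⟩ : ∃ A : ℕ → Polynomial K, ∀ k, A k =
    (tay F (fun i => algebraMap ℂ (Polynomial K) (p i) + Polynomial.X * algebraMap ℂ (Polynomial K) (e1 i))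
      (fun i => (Polynomial.C x - Polynomial.X) * algebraMap ℂ (Polynomial K) (e1 i)
        + Polynomial.C z * algebraMap ℂ (Polynomial K) (e3 i)
        + Polynomial.C u * algebraMap ℂ (Polynomial K) (e4 i))).coeff k := ⟨_, fun _ => rfl⟩
  obtain ⟨Q, hQ⟩ : ∃ Q : Polynomial K, Q = algebraMap ℂ (Polynomial K) e * Polynomial.X
    + algebraMap ℂ (Polynomial K) f * Polynomial.X ^ 2 := ⟨_, rfl⟩
  let φ : Polynomial K →ₐ[ℂ] L := (Polynomial.aeval s).restrictScalars ℂ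
  let χ : Polynomial K →ₐ[ℂ] K := (Polynomial.aeval (0 : K)).restrictScalars ℂ
  have φX : φ Polynomial.X = s := Polynomial.aeval_X s
  have φC : ∀ c : K, φ (Polynomial.C c) = c := fun c => Polynomial.aeval_C s c
  have φι : ∀ c : ℂ, φ (algebraMap ℂ (Polynomial K) c) = algebraMap ℂ L c := fun c => φ.commutes c
  have χX : χ Polynomial.X = 0 := Polynomial.aeval_X 0
  have χC : ∀ c : K, χ (Polynomial.C c) = c := fun c => Polynomial.aeval_C 0 c
  have χι : ∀ c : ℂ, χ (algebraMap ℂ (Polynomial K) c) = algebraMap ℂ K c := fun c => χ.commutes c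
  have hφA : ∀ k, φ (A k) = D k := by
    intro k
    rw [hA, tay_coeff_map, hD]
    simp only [map_add, map_mul, map_sub, φX, φC, φι]
  have hφQ : φ Q = q := by
    rw [hQ, hq]
    simp only [map_add, map_mul, map_pow, φX, φι]
  have hχQ : χ Q = 0 := by
    rw [hQ]
    simp only [map_add, map_mul, map_pow, χX]
    ring
  have hχA : χ (A 1) = z * algebraMap ℂ K δ := by
    rw [hA, tay_coeff_map]
    simp only [map_add, map_mul, map_sub, χX, χC, χι, zero_mul, add_zero]
    exact hlin K (x - 0) z u
  refine root_mem K hK (8 * Q ^ 4 - 8 * Q ^ 3 * Polynomial.C W + 4 * Q ^ 2 * A 1 + 4 * Q ^ 2 * A 2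
    - A 1 ^ 2) ?_ s ?_
  · intro h
    have h' := congrArg χ h
    simp only [map_add, map_sub, map_mul, map_pow, map_ofNat, map_zero, hχQ, hχA] at h'
    have h'' : (z * algebraMap ℂ K δ) ^ 2 = 0 := by linear_combination -h'
    have h3 := pow_eq_zero_iff two_ne_zero |>.1 h''
    rcases mul_eq_zero.1 h3 with h3 | h3
    · exact hz h3
    · exact hδ ((map_eq_zero _).1 h3)
  · change φ _ = 0
    simp only [map_add, map_sub, map_mul, map_pow, map_ofNat, hφQ, hφA, φC]
    exact hE


theorem caseII (F : MvPolynomial (Fin 4) ℂ)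
    (hdeg : F.IsHomogeneous 4)
    (hsm : ∀ v : Fin 4 → ℂ, (∀ i, eval v (pderiv i F) = 0) → v = 0)
    (p e1 e3 e4 : Fin 4 → ℂ) (hli : LinearIndependent ℂ ![p, e1, e3, e4])
    (e f δ : ℂ) (hef : ¬ (e = 0 ∧ f = 0)) (hδ : δ ≠ 0)
    (h0 : (tay F p e1).coeff 0 = 0) (h1 : (tay F p e1).coeff 1 = 0)
    (h2 : (tay F p e1).coeff 2 = e ^ 2) (h3 : (tay F p e1).coeff 3 = 2 * e * f)
    (h4 : (tay F p e1).coeff 4 = f ^ 2)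
    (hd3 : (tay F p e3).coeff 1 = δ) (hd4 : (tay F p e4).coeff 1 = 0) :
    ∃ f : FractionRing (MvPolynomial (Fin 4) ℂ ⧸
        (Ideal.span {X 3 ^ 2 - rename Fin.castSucc (dehom F)})) →ₐ[ℂ] CRatFunc 3,
      Function.Injective f := by
  have hq : ∀ (R : Type) [CommRing R] [Algebra ℂ R] (s : R),
      aeval (fun i => algebraMap ℂ R (p i) + s * algebraMap ℂ R (e1 i)) F
        = (algebraMap ℂ R e * s + algebraMap ℂ R f * s ^ 2) ^ 2 := by
    intro R _ _ s
    rw [tay_sum F hdeg]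
    simp only [tay_base_coeff, h0, h1, h2, h3, h4, map_zero, map_mul, map_pow, map_ofNat]
    ring
  have hlin : ∀ (R : Type) [CommRing R] [Algebra ℂ R] (a b c : R),
      (tay F (fun i => algebraMap ℂ R (p i)) (fun i => a * algebraMap ℂ R (e1 i)
        + b * algebraMap ℂ R (e3 i) + c * algebraMap ℂ R (e4 i))).coeff 1 = b * algebraMap ℂ R δ := by
    intro R _ _ a b c
    rw [tay_coeff_one] at h1 hd3 hd4 ⊢
    simp only [aeval_base]
    have h1' := congrArg (algebraMap ℂ R) h1
    have hd3' := congrArg (algebraMap ℂ R) hd3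
    have hd4' := congrArg (algebraMap ℂ R) hd4
    simp only [map_sum, map_mul, map_zero] at h1' hd3' hd4'
    simp only [Fin.sum_univ_four] at h1' hd3' hd4' ⊢
    linear_combination a * h1' + b * hd3' + c * hd4'
  let R := MvPolynomial (Fin 3) ℂ
  let L := CRatFunc 3
  let ψ : R →ₐ[ℂ] L := IsScalarTower.toAlgHom ℂ R L
  have hψ : Function.Injective ψ := IsFractionRing.injective R L
  let PR : Fin 4 → R := fun i => algebraMap ℂ R (p i) + X 0 * algebraMap ℂ R (e1 i)
  let dR : Fin 4 → R := fun i => X 2 * algebraMap ℂ R (e1 i) + 1 * algebraMap ℂ R (e3 i)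
    + X 1 * algebraMap ℂ R (e4 i)
  let Γ : ℕ → R := fun k => (tay F PR dR).coeff k
  let qR : R := algebraMap ℂ R e * X 0 + algebraMap ℂ R f * X 0 ^ 2
  have hΓ0 : Γ 0 = qR ^ 2 := by
    change (tay F PR dR).coeff 0 = _
    rw [tay_coeff_zero]
    exact hq R (X 0)
  let N1 : R := 16 * qR ^ 4 * Γ 3 - 2 * Γ 1 * (4 * qR ^ 2 * Γ 2 - Γ 1 ^ 2)
  let N2 : R := (4 * qR ^ 2 * Γ 2 - Γ 1 ^ 2) ^ 2 - 64 * qR ^ 6 * Γ 4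
  let ev : R →ₐ[ℂ] ℂ := aeval (fun _ => (0 : ℂ))
  have evX : ∀ i, ev (X i) = 0 := fun i => aeval_X _ _
  have evc : ∀ c, ev (algebraMap ℂ R c) = algebraMap ℂ ℂ c := fun c => ev.commutes c
  have evq : ev qR = 0 := by
    simp only [qR, map_add, map_mul, map_pow, evX]
    ring
  have evΓ : ev (Γ 1) = δ := by
    change ev ((tay F PR dR).coeff 1) = _
    rw [tay_coeff_map]
    have := hlin ℂ 0 1 0
    simp only [one_mul] at this
    simp only [PR, dR, map_add, map_mul, evX, evc, one_mul, zero_mul, add_zero] at this ⊢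
    exact this
  have hN1 : N1 ≠ 0 := by
    intro h
    have h' := congrArg ev h
    simp only [N1, map_sub, map_mul, map_pow, map_ofNat, map_zero, evq, evΓ] at h'
    apply hδ
    have : δ ^ 3 = 0 := by linear_combination h' / 2
    exact pow_eq_zero_iff (three_ne_zero) |>.1 this
  have hN2 : N2 ≠ 0 := by
    intro h
    have h' := congrArg ev h
    simp only [N2, map_sub, map_mul, map_pow, map_ofNat, map_zero, evq, evΓ] at h'
    apply hδ
    have : δ ^ 4 = 0 := by linear_combination h'
    exact pow_eq_zero_iff (four_ne_zero) |>.1 this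
  have hqR : qR ≠ 0 := by
    intro h
    let f1 : R →ₐ[ℂ] ℂ := aeval (fun _ => (1 : ℂ))
    let f2 : R →ₐ[ℂ] ℂ := aeval (fun _ => (-1 : ℂ))
    have f1X : ∀ i, f1 (X i) = 1 := fun i => aeval_X _ _
    have f1c : ∀ c, f1 (algebraMap ℂ R c) = c := fun c => f1.commutes c
    have f2X : ∀ i, f2 (X i) = -1 := fun i => aeval_X _ _
    have f2c : ∀ c, f2 (algebraMap ℂ R c) = c := fun c => f2.commutes c
    have ha := congrArg f1 h
    have hb := congrArg f2 h
    simp only [qR, map_add, map_mul, map_pow, f1X, f1c, f2X, f2c, map_zero] at ha hb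
    apply hef
    constructor
    · linear_combination (ha - hb) / 2
    · linear_combination (ha + hb) / 2
  -- pass to `L`
  have ne : ∀ {a : R}, a ≠ 0 → ψ a ≠ 0 := fun h h' => h (hψ (by rw [h', map_zero]))
  have hn1 := ne hN1
  have hn2 := ne hN2
  have hq0 := ne hqR
  obtain ⟨s, hs⟩ : ∃ s, s = ψ (X 0) := ⟨_, rfl⟩
  obtain ⟨t, ht⟩ : ∃ s, s = ψ (X 1) := ⟨_, rfl⟩
  obtain ⟨r, hr⟩ : ∃ s, s = ψ (X 2) := ⟨_, rfl⟩
  have en1 : ψ N1 = 16 * ψ qR ^ 4 * ψ (Γ 3) - 2 * ψ (Γ 1) * (4 * ψ qR ^ 2 * ψ (Γ 2) - ψ (Γ 1) ^ 2) := by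
    simp only [N1, map_sub, map_mul, map_pow, map_ofNat]
  have en2 : ψ N2 = (4 * ψ qR ^ 2 * ψ (Γ 2) - ψ (Γ 1) ^ 2) ^ 2 - 64 * ψ qR ^ 6 * ψ (Γ 4) := by
    simp only [N2, map_sub, map_mul, map_pow, map_ofNat]
  have eΓ0 : ψ (Γ 0) = ψ qR ^ 2 := by rw [hΓ0, map_pow]
  let ι := algebraMap ℂ L
  have hψι : ∀ c, ψ (algebraMap ℂ R c) = ι c := fun c => ψ.commutes c
  have eqs : ψ qR = ι e * s + ι f * s ^ 2 := by
    simp only [qR, map_add, map_mul, map_pow, hψι, hs]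
  have eΓ : ∀ k, ψ (Γ k) = (tay F (fun i => ι (p i) + s * ι (e1 i))
      (fun i => r * ι (e1 i) + 1 * ι (e3 i) + t * ι (e4 i))).coeff k := by
    intro k
    change ψ ((tay F PR dR).coeff k) = _
    rw [tay_coeff_map]
    simp only [PR, dR, map_add, map_mul, map_one, hψι, hs, ht, hr]
  generalize hG0 : ψ (Γ 0) = G0 at *
  obtain ⟨G1, hG1⟩ : ∃ s, s = ψ (Γ 1) := ⟨_, rfl⟩
  obtain ⟨G2, hG2⟩ : ∃ s, s = ψ (Γ 2) := ⟨_, rfl⟩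
  obtain ⟨G3, hG3⟩ : ∃ s, s = ψ (Γ 3) := ⟨_, rfl⟩
  obtain ⟨G4, hG4⟩ : ∃ s, s = ψ (Γ 4) := ⟨_, rfl⟩
  obtain ⟨q, hqq⟩ : ∃ s, s = ψ qR := ⟨_, rfl⟩
  obtain ⟨n1, hnn1⟩ : ∃ s, s = ψ N1 := ⟨_, rfl⟩
  obtain ⟨n2, hnn2⟩ : ∃ s, s = ψ N2 := ⟨_, rfl⟩
  rw [← hG1, ← hG2, ← hG3, ← hqq, ← hnn1] at en1
  rw [← hG1, ← hG2, ← hG4, ← hqq, ← hnn2] at en2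
  rw [← hqq] at eqs eΓ0 hq0
  rw [← hnn1] at hn1
  rw [← hnn2] at hn2
  let ρ : L := 4 * q ^ 2 * n1 / n2
  have hρ : ρ ≠ 0 := div_ne_zero (mul_ne_zero (mul_ne_zero (by norm_num : (4 : L) ≠ 0) (pow_ne_zero _ hq0)) hn1) hn2
  have hρn : ρ * n2 = 4 * q ^ 2 * n1 := div_mul_cancel₀ _ hn2
  let W : L := (8 * q ^ 4 + 4 * q ^ 2 * G1 * ρ + (4 * q ^ 2 * G2 - G1 ^ 2) * ρ ^ 2) / (8 * q ^ 3)
  have h8 : (8 : L) * q ^ 3 ≠ 0 := mul_ne_zero (by norm_num) (pow_ne_zero _ hq0)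
  have hWn : W * (8 * q ^ 3) = 8 * q ^ 4 + 4 * q ^ 2 * G1 * ρ + (4 * q ^ 2 * G2 - G1 ^ 2) * ρ ^ 2 :=
    div_mul_cancel₀ _ h8
  have hWsq : W ^ 2 = G0 + G1 * ρ + G2 * ρ ^ 2 + G3 * ρ ^ 3 + G4 * ρ ^ 4 := by
    apply mul_right_cancel₀ (pow_ne_zero 2 h8)
    rw [← mul_pow, hWn, eΓ0]
    rw [en1, en2] at hρn
    linear_combination ρ ^ 3 * hρn
  have hWF : aeval (fun i => ι (p i) + (s + ρ * r) * ι (e1 i) + ρ * ι (e3 i) + (ρ * t) * ι (e4 i)) F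
      = W ^ 2 := by
    rw [hWsq, ← hG0, hG1, hG2, hG3, hG4]
    simp only [eΓ]
    rw [← tay_sum F hdeg]
    congr 2
    funext i
    ring
  refine reduce F hdeg hsm p e1 e3 e4 hli (s + ρ * r) ρ (ρ * t) W hWF ?_
  intro K hK hx hz hu
  have htK : t ∈ K := by
    have := K.div_mem hu hz
    rwa [mul_div_cancel_left₀ _ hρ] at this
  have hWK : W ∈ K := by
    apply sq_mem K hK
    rw [← hWF]
    apply aeval_mem
    intro i
    exact K.add_mem (K.add_mem (K.add_mem (K.algebraMap_mem _) (K.mul_mem hx (K.algebraMap_mem _)))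
      (K.mul_mem hz (K.algebraMap_mem _))) (K.mul_mem hu (K.algebraMap_mem _))
  have hsK : s ∈ K := by
    have hD : ∀ k, ρ ^ k * ψ (Γ k) = (tay F (fun i => ι (p i) + s * ι (e1 i))
      (fun i => ((s + ρ * r) - s) * ι (e1 i) + ρ * ι (e3 i) + (ρ * t) * ι (e4 i))).coeff k := by
      intro k
      rw [eΓ, ← tay_scale]
      congr 2
      funext i
      ring
    refine caseII_s F p e1 e3 e4 e f δ hδ hlin K hK s ⟨_, hx⟩ ⟨_, hz⟩ ⟨_, hu⟩ ⟨_, hWK⟩ ?_ _ hD q eqs ?_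
    · intro h
      exact hρ (congrArg Subtype.val h)
    · simp only [← hG1, ← hG2]
      linear_combination -hWn
  have hrK : r ∈ K := by
    have := K.div_mem (K.sub_mem hx hsK) hz
    rwa [add_sub_cancel_left, mul_div_cancel_left₀ _ hρ] at this
  intro i
  fin_cases i
  · exact hs ▸ hsK
  · exact ht ▸ htK
  · exact hr ▸ hrK


theorem tay_aeval (G : MvPolynomial (Fin 4) ℂ) {R : Type} [CommRing R] [Algebra ℂ R]
    (p d : Fin 4 → ℂ) (s : R) :
    Polynomial.aeval s (tay G p d) = aeval (fun i => algebraMap ℂ R (p i) + s * algebraMap ℂ R (d i)) G := by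
  unfold tay
  rw [← AlgHom.restrictScalars_apply ℂ, ← AlgHom.comp_apply, comp_aeval]
  simp only [mul_comm s]
  simp

/-- the polynomial `s ↦ dF(p + s e1)(v)`. -/
noncomputable def dpol (F : MvPolynomial (Fin 4) ℂ) (p e1 v : Fin 4 → ℂ) : Polynomial ℂ :=
  ∑ i, Polynomial.C (v i) * tay (pderiv i F) p e1

theorem dpol_aeval (F : MvPolynomial (Fin 4) ℂ) {R : Type} [CommRing R] [Algebra ℂ R]
    (p e1 v : Fin 4 → ℂ) (s : R) :
    Polynomial.aeval s (dpol F p e1 v) = ∑ i, algebraMap ℂ R (v i) *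
      aeval (fun i => algebraMap ℂ R (p i) + s * algebraMap ℂ R (e1 i)) (pderiv i F) := by
  simp only [dpol, map_sum, map_mul, Polynomial.aeval_C, tay_aeval]

theorem dpol_deriv_aeval (F : MvPolynomial (Fin 4) ℂ) {R : Type} [CommRing R] [Algebra ℂ R]
    (p e1 v : Fin 4 → ℂ) (s : R) :
    Polynomial.aeval s (Polynomial.derivative (dpol F p e1 v)) = ∑ i, ∑ j, algebraMap ℂ R (v i) *
      algebraMap ℂ R (e1 j) *
      aeval (fun i => algebraMap ℂ R (p i) + s * algebraMap ℂ R (e1 i)) (pderiv j (pderiv i F)) := by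
  simp only [dpol, Polynomial.derivative_C_mul, tay_deriv, map_sum, map_mul,
    Polynomial.aeval_C, tay_aeval, Finset.mul_sum, mul_assoc]

theorem dpol_line (F : MvPolynomial (Fin 4) ℂ) (p e1 : Fin 4 → ℂ) (h : tay F p e1 = 0) :
    dpol F p e1 e1 = 0 := by
  have := tay_deriv F p e1
  rw [h, Polynomial.derivative_zero] at this
  exact this.symm

section
variable (F : MvPolynomial (Fin 4) ℂ) (p e1 e3 e4 : Fin 4 → ℂ)

noncomputable def wr : Polynomial ℂ :=
  dpol F p e1 e4 * Polynomial.derivative (dpol F p e1 e3)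
    - dpol F p e1 e3 * Polynomial.derivative (dpol F p e1 e4)

noncomputable def fdir {R : Type} [CommRing R] [Algebra ℂ R] (s : R) : Fin 4 → R := fun i =>
  Polynomial.aeval s (dpol F p e1 e4) * algebraMap ℂ R (e3 i)
    - Polynomial.aeval s (dpol F p e1 e3) * algebraMap ℂ R (e4 i)

noncomputable def c2f {R : Type} [CommRing R] [Algebra ℂ R] (s : R) : R :=
  (tay F (fun i => algebraMap ℂ R (p i) + s * algebraMap ℂ R (e1 i)) (fdir F p e1 e3 e4 s)).coeff 2

noncomputable def Gf {R : Type} [CommRing R] [Algebra ℂ R] (s κ : R) (k : ℕ) : R :=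
  (tay F (fun i => algebraMap ℂ R (p i) + s * algebraMap ℂ R (e1 i))
    (fun i => (κ ^ 2 - c2f F p e1 e3 e4 s) * algebraMap ℂ R (e1 i)
      + Polynomial.aeval s (wr F p e1 e3 e4) * fdir F p e1 e3 e4 s i)).coeff k

theorem poly_aeval_map {R S : Type} [CommRing R] [Algebra ℂ R] [CommRing S] [Algebra ℂ S]
    (φ : R →ₐ[ℂ] S) (s : R) (A : Polynomial ℂ) :
    φ (Polynomial.aeval s A) = Polynomial.aeval (φ s) A := by
  rw [Polynomial.aeval_algHom_apply]

theorem fdir_map {R S : Type} [CommRing R] [Algebra ℂ R] [CommRing S] [Algebra ℂ S]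
    (φ : R →ₐ[ℂ] S) (s : R) (i : Fin 4) :
    φ (fdir F p e1 e3 e4 s i) = fdir F p e1 e3 e4 (φ s) i := by
  simp only [fdir, map_sub, map_mul, poly_aeval_map, AlgHom.commutes]

theorem c2f_map {R S : Type} [CommRing R] [Algebra ℂ R] [CommRing S] [Algebra ℂ S]
    (φ : R →ₐ[ℂ] S) (s : R) :
    φ (c2f F p e1 e3 e4 s) = c2f F p e1 e3 e4 (φ s) := by
  unfold c2f
  rw [tay_coeff_map]
  simp only [map_add, map_mul, AlgHom.commutes, fdir_map]

theorem Gf_map {R S : Type} [CommRing R] [Algebra ℂ R] [CommRing S] [Algebra ℂ S]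
    (φ : R →ₐ[ℂ] S) (s κ : R) (k : ℕ) :
    φ (Gf F p e1 e3 e4 s κ k) = Gf F p e1 e3 e4 (φ s) (φ κ) k := by
  unfold Gf
  rw [tay_coeff_map]
  simp only [map_add, map_sub, map_pow, map_mul, AlgHom.commutes, fdir_map, c2f_map, poly_aeval_map]

theorem Gf_zero {R : Type} [CommRing R] [Algebra ℂ R] (h : tay F p e1 = 0) (s κ : R) :
    Gf F p e1 e3 e4 s κ 0 = 0 := by
  unfold Gf
  rw [tay_coeff_zero, ← tay_aeval, h, map_zero]

theorem Gf_one {R : Type} [CommRing R] [Algebra ℂ R] (h : tay F p e1 = 0) (s κ : R) :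
    Gf F p e1 e3 e4 s κ 1 = 0 := by
  unfold Gf
  rw [tay_coeff_one]
  have h1 := dpol_aeval F p e1 e1 s
  rw [dpol_line F p e1 h, map_zero] at h1
  have h3 := dpol_aeval F p e1 e3 s
  have h4 := dpol_aeval F p e1 e4 s
  simp only [fdir]
  generalize Polynomial.aeval s (wr F p e1 e3 e4) = w
  generalize Polynomial.aeval s (dpol F p e1 e3) = a at *
  generalize Polynomial.aeval s (dpol F p e1 e4) = b at *
  generalize κ ^ 2 - c2f F p e1 e3 e4 s = n
  simp only [Fin.sum_univ_four] at *
  linear_combination - n * h1 - w * b * h3 + w * a * h4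

theorem Gf_two {R : Type} [Field R] [Algebra ℂ R] [CharZero R] (h : tay F p e1 = 0) (s κ : R) :
    Gf F p e1 e3 e4 s κ 2 = (Polynomial.aeval s (wr F p e1 e3 e4) * κ) ^ 2 := by
  have hc : c2f F p e1 e3 e4 s * 2 = _ := tay_coeff_two F _ _
  have h1 := dpol_deriv_aeval F p e1 e1 s
  rw [dpol_line F p e1 h, Polynomial.derivative_zero, map_zero] at h1
  have h3 := dpol_deriv_aeval F p e1 e3 s
  have h4 := dpol_deriv_aeval F p e1 e4 s
  have hw : Polynomial.aeval s (wr F p e1 e3 e4) =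
    Polynomial.aeval s (dpol F p e1 e4) * Polynomial.aeval s (Polynomial.derivative (dpol F p e1 e3))
    - Polynomial.aeval s (dpol F p e1 e3) * Polynomial.aeval s (Polynomial.derivative (dpol F p e1 e4)) := by
    simp only [wr, map_sub, map_mul]
  have hg : Gf F p e1 e3 e4 s κ 2 * 2 = _ := tay_coeff_two F _ _
  have hsymm : ∀ i j, aeval (fun i => algebraMap ℂ R (p i) + s * algebraMap ℂ R (e1 i)) (pderiv i (pderiv j F))
    = aeval (fun i => algebraMap ℂ R (p i) + s * algebraMap ℂ R (e1 i)) (pderiv j (pderiv i F)) := by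
    intro i j
    rw [pderiv_comm']
  apply mul_right_cancel₀ (two_ne_zero (α := R))
  rw [hg]
  simp only [fdir] at *
  generalize Polynomial.aeval s (wr F p e1 e3 e4) = w at *
  generalize Polynomial.aeval s (dpol F p e1 e3) = a at *
  generalize Polynomial.aeval s (dpol F p e1 e4) = b at *
  generalize Polynomial.aeval s (Polynomial.derivative (dpol F p e1 e3)) = a' at *
  generalize Polynomial.aeval s (Polynomial.derivative (dpol F p e1 e4)) = b' at *
  generalize c2f F p e1 e3 e4 s = c at *
  generalize hH : (fun i j => aeval (fun i => algebraMap ℂ R (p i) + s * algebraMap ℂ R (e1 i)) (pderiv j (pderiv i F))) = H at *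
  have hH' : ∀ i j, aeval (fun i => algebraMap ℂ R (p i) + s * algebraMap ℂ R (e1 i)) (pderiv j (pderiv i F)) = H i j := by
    intro i j; rw [← hH]
  simp only [hH'] at *
  simp only [Fin.sum_univ_four] at *
  rw [hsymm 1 0, hsymm 2 0, hsymm 3 0, hsymm 2 1, hsymm 3 1, hsymm 3 2] at *
  clear hH hH' hsymm hg
  generalize algebraMap ℂ R = ι at *
  linear_combination -(κ ^ 2 - c) ^ 2 * h1 - 2 * (κ ^ 2 - c) * w * b * h3 + 2 * (κ ^ 2 - c) * w * a * h4
    - 2 * (κ ^ 2 - c) * w * hw - w ^ 2 * hc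
end


theorem caseI (F : MvPolynomial (Fin 4) ℂ)
    (hdeg : F.IsHomogeneous 4)
    (hsm : ∀ v : Fin 4 → ℂ, (∀ i, eval v (pderiv i F) = 0) → v = 0)
    (p e1 e3 e4 : Fin 4 → ℂ) (hli : LinearIndependent ℂ ![p, e1, e3, e4])
    (δ : ℂ) (hδ : δ ≠ 0) (hline : tay F p e1 = 0)
    (hd3 : (tay F p e3).coeff 1 = δ) (hd4 : (tay F p e4).coeff 1 = 0)
    (hwr : wr F p e1 e3 e4 ≠ 0) :
    ∃ f : FractionRing (MvPolynomial (Fin 4) ℂ ⧸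
        (Ideal.span {X 3 ^ 2 - rename Fin.castSucc (dehom F)})) →ₐ[ℂ] CRatFunc 3,
      Function.Injective f := by
  have hB0 : dpol F p e1 e4 ≠ 0 := by
    intro h
    apply hwr
    simp [wr, h]
  have hA00 : ∀ (R : Type) [CommRing R] [Algebra ℂ R],
      Polynomial.aeval (0 : R) (dpol F p e1 e3) = algebraMap ℂ R δ := by
    intro R _ _
    rw [dpol_aeval, ← hd3, tay_coeff_one]
    simp only [zero_mul, add_zero, aeval_base, map_sum, map_mul]
  have hB00 : ∀ (R : Type) [CommRing R] [Algebra ℂ R],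
      Polynomial.aeval (0 : R) (dpol F p e1 e4) = 0 := by
    intro R _ _
    rw [dpol_aeval]
    have := congrArg (algebraMap ℂ R) hd4
    rw [tay_coeff_one] at this
    simp only [zero_mul, add_zero, aeval_base, map_sum, map_mul, map_zero] at this ⊢
    exact this
  let R := MvPolynomial (Fin 3) ℂ
  let L := CRatFunc 3
  let ψ : R →ₐ[ℂ] L := IsScalarTower.toAlgHom ℂ R L
  have hψ : Function.Injective ψ := IsFractionRing.injective R L
  have ne : ∀ {a : R}, a ≠ 0 → ψ a ≠ 0 := fun h h' => h (hψ (by rw [h', map_zero]))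
  have hpol : ∀ A : Polynomial ℂ, A ≠ 0 → Polynomial.aeval (X 0 : R) A ≠ 0 := by
    intro A hA h
    let ev : R →ₐ[ℂ] Polynomial ℂ := aeval (fun _ => Polynomial.X)
    have evX : ev (X 0) = Polynomial.X := aeval_X _ _
    have h' := congrArg ev h
    rw [poly_aeval_map, evX, map_zero, Polynomial.aeval_X_left_apply] at h'
    exact hA h'
  have hX : ∀ i, (X i : R) ≠ 0 := fun i => X_ne_zero i
  let σ : R →ₐ[ℂ] R := aeval ![X 0, X 1, X 2 + 1]
  have σ0 : σ (X 0) = X 0 := aeval_X _ _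
  have σ1 : σ (X 1) = X 1 := aeval_X _ _
  have σ2 : σ (X 2) = X 2 + 1 := aeval_X _ _
  let G : ℕ → R := fun k => Gf F p e1 e3 e4 (X 0) (X 1) k
  have σG : ∀ k, σ (G k) = G k := by
    intro k
    simp only [G]
    rw [Gf_map, σ0, σ1]
  have hD : (X 2 ^ 2 - G 4 : R) ≠ 0 := by
    intro h
    have h' := congrArg σ h
    simp only [map_sub, map_pow, σ2, σG, map_zero] at h'
    have h2 : (2 * X 2 + 1 : R) = 0 := by linear_combination h' - h
    let ev : R →ₐ[ℂ] ℂ := aeval (fun _ => 0)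
    have evX : ev (X 2) = 0 := aeval_X _ _
    have h3 := congrArg ev h2
    simp only [map_add, map_mul, evX, map_one, map_zero, mul_zero, zero_add] at h3
    exact one_ne_zero h3
  have hN : (G 3 - 2 * Polynomial.aeval (X 0 : R) (wr F p e1 e3 e4) * X 1 * X 2 : R) ≠ 0 := by
    intro h
    have h' := congrArg σ h
    simp only [map_sub, map_mul, map_ofNat, poly_aeval_map, σ0, σ1, σ2, σG, map_zero] at h'
    have h2 : (2 * (Polynomial.aeval (X 0 : R) (wr F p e1 e3 e4) * X 1) : R) = 0 := by
      linear_combination h - h'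
    have h3 : (2 : R) ≠ 0 := two_ne_zero
    exact mul_ne_zero h3 (mul_ne_zero (hpol _ hwr) (hX 1)) h2
  let ι := algebraMap ℂ L
  obtain ⟨s, hs⟩ : ∃ s, s = ψ (X 0) := ⟨_, rfl⟩
  obtain ⟨κ, hκ⟩ : ∃ s, s = ψ (X 1) := ⟨_, rfl⟩
  obtain ⟨h, hh⟩ : ∃ s, s = ψ (X 2) := ⟨_, rfl⟩
  have hD' := ne hD
  have hN' := ne hN
  have ψG : ∀ k, ψ (G k) = Gf F p e1 e3 e4 s κ k := by
    intro k
    simp only [G]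
    rw [Gf_map, hs, hκ]
  simp only [map_sub, map_mul, map_pow, map_ofNat, poly_aeval_map, ψG, ← hs, ← hκ, ← hh] at hD' hN'
  have hw0 : Polynomial.aeval s (wr F p e1 e3 e4) ≠ 0 := by
    rw [hs, ← poly_aeval_map]; exact ne (hpol _ hwr)
  have hb0 : Polynomial.aeval s (dpol F p e1 e4) ≠ 0 := by
    rw [hs, ← poly_aeval_map]; exact ne (hpol _ hB0)
  have g0 := Gf_zero F p e1 e3 e4 hline s κ
  have g1 := Gf_one F p e1 e3 e4 hline s κ
  have g2 := Gf_two F p e1 e3 e4 hline s κ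
  obtain ⟨w, hw⟩ : ∃ w, w = Polynomial.aeval s (wr F p e1 e3 e4) := ⟨_, rfl⟩
  obtain ⟨a, ha⟩ : ∃ w, w = Polynomial.aeval s (dpol F p e1 e3) := ⟨_, rfl⟩
  obtain ⟨b, hb⟩ : ∃ w, w = Polynomial.aeval s (dpol F p e1 e4) := ⟨_, rfl⟩
  obtain ⟨n, hn⟩ : ∃ w, w = κ ^ 2 - c2f F p e1 e3 e4 s := ⟨_, rfl⟩
  obtain ⟨G3, hG3⟩ : ∃ w, w = Gf F p e1 e3 e4 s κ 3 := ⟨_, rfl⟩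
  obtain ⟨G4, hG4⟩ : ∃ w, w = Gf F p e1 e3 e4 s κ 4 := ⟨_, rfl⟩
  rw [← hG4] at hD'
  rw [← hG3, ← hw] at hN'
  rw [← hw] at hw0 g2
  rw [← hb] at hb0
  obtain ⟨ρ, hρd⟩ : ∃ ρ, ρ = (G3 - 2 * w * κ * h) / (h ^ 2 - G4) := ⟨_, rfl⟩
  have hρ : ρ ≠ 0 := hρd ▸ div_ne_zero hN' hD'
  have hρn : ρ * (h ^ 2 - G4) = G3 - 2 * w * κ * h := hρd ▸ div_mul_cancel₀ _ hD'
  obtain ⟨W, hW⟩ : ∃ W, W = ρ * (w * κ + ρ * h) := ⟨_, rfl⟩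
  have hWF : aeval (fun i => ι (p i) + (s + ρ * n) * ι (e1 i) + (ρ * (w * b)) * ι (e3 i)
      + (-(ρ * (w * a))) * ι (e4 i)) F = W ^ 2 := by
    have h1 := tay_sum F hdeg (fun i => algebraMap ℂ L (p i) + s * algebraMap ℂ L (e1 i))
      (fun i => (κ ^ 2 - c2f F p e1 e3 e4 s) * algebraMap ℂ L (e1 i)
      + Polynomial.aeval s (wr F p e1 e3 e4) * fdir F p e1 e3 e4 s i) ρ
    change _ = Gf F p e1 e3 e4 s κ 0 + Gf F p e1 e3 e4 s κ 1 * ρ + Gf F p e1 e3 e4 s κ 2 * ρ ^ 2 +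
      Gf F p e1 e3 e4 s κ 3 * ρ ^ 3 + Gf F p e1 e3 e4 s κ 4 * ρ ^ 4 at h1
    rw [g0, g1, g2, ← hG3, ← hG4] at h1
    have h2 : W ^ 2 = 0 + 0 * ρ + (w * κ) ^ 2 * ρ ^ 2 + G3 * ρ ^ 3 + G4 * ρ ^ 4 := by
      rw [hW]
      linear_combination ρ ^ 3 * hρn
    rw [h2, ← h1]
    congr 2
    funext i
    simp only [fdir, ← hw, ← ha, ← hb, ← hn, ι]
    ring
  have hz0 : ρ * (w * b) ≠ 0 := mul_ne_zero hρ (mul_ne_zero hw0 hb0)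
  refine reduce F hdeg hsm p e1 e3 e4 hli (s + ρ * n) (ρ * (w * b)) (-(ρ * (w * a))) W hWF ?_
  intro K hK hx hz hu
  have hWK : W ∈ K := by
    apply sq_mem K hK
    rw [← hWF]
    apply aeval_mem
    intro i
    exact K.add_mem (K.add_mem (K.add_mem (K.algebraMap_mem _) (K.mul_mem hx (K.algebraMap_mem _)))
      (K.mul_mem hz (K.algebraMap_mem _))) (K.mul_mem hu (K.algebraMap_mem _))
  have hsK : s ∈ K := by
    let Z : K := ⟨_, hz⟩
    let U : K := ⟨_, hu⟩
    refine root_mem K hK (Polynomial.C U * (dpol F p e1 e4).map (algebraMap ℂ K)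
      + Polynomial.C Z * (dpol F p e1 e3).map (algebraMap ℂ K)) ?_ s ?_
    · intro h0
      have h1 := congrArg (Polynomial.aeval (0 : K)) h0
      simp only [map_add, map_mul, Polynomial.aeval_C, Polynomial.aeval_map_algebraMap, hA00 K, hB00 K,
        map_zero, mul_zero, zero_add] at h1
      rcases mul_eq_zero.1 h1 with h1 | h1
      · exact hz0 (congrArg Subtype.val h1)
      · exact hδ ((map_eq_zero _).1 h1)
    · simp only [map_add, map_mul, Polynomial.aeval_C, Polynomial.aeval_map_algebraMap, ← ha, ← hb]
      change (-(ρ * (w * a))) * b + (ρ * (w * b)) * a = 0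
      ring
  have polK : ∀ A : Polynomial ℂ, Polynomial.aeval s A ∈ K := by
    intro A
    have : K.val (Polynomial.aeval (⟨s, hsK⟩ : K) A) = Polynomial.aeval s A := by
      rw [poly_aeval_map]; rfl
    rw [← this]
    exact Subtype.mem _
  have hwK : w ∈ K := hw ▸ polK _
  have hbK : b ∈ K := hb ▸ polK _
  have hρK : ρ ∈ K := by
    have := K.div_mem hz (K.mul_mem hwK hbK)
    rwa [mul_div_cancel_right₀ _ (mul_ne_zero hw0 hb0)] at this
  have hnK : n ∈ K := by
    have := K.div_mem (K.sub_mem hx hsK) hρK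
    rwa [add_sub_cancel_left, mul_div_cancel_left₀ _ hρ] at this
  have hcK : c2f F p e1 e3 e4 s ∈ K := by
    have : K.val (c2f F p e1 e3 e4 (⟨s, hsK⟩ : K)) = c2f F p e1 e3 e4 s := by
      rw [c2f_map]; rfl
    rw [← this]
    exact Subtype.mem _
  have hκK : κ ∈ K := by
    apply sq_mem K hK
    have : κ ^ 2 = n + c2f F p e1 e3 e4 s := by rw [hn]; ring
    rw [this]
    exact K.add_mem hnK hcK
  have hhK : h ∈ K := by
    have h1 : h = (W / ρ - w * κ) / ρ := by
      rw [hW, mul_div_cancel_left₀ _ hρ, add_sub_cancel_left, mul_div_cancel_left₀ _ hρ]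
    rw [h1]
    exact K.div_mem (K.sub_mem (K.div_mem hWK hρK) (K.mul_mem hwK hκK)) hρK
  intro i
  fin_cases i
  · exact hs ▸ hsK
  · exact hκ ▸ hκK
  · exact hh ▸ hhK


theorem kill (F : MvPolynomial (Fin 4) ℂ)
    (hsm : ∀ v : Fin 4 → ℂ, (∀ i, eval v (pderiv i F) = 0) → v = 0)
    (p e1 e3 e4 : Fin 4 → ℂ) (hli : LinearIndependent ℂ ![p, e1, e3, e4]) (v : Fin 4 → ℂ)
    (h0 : ∑ i, p i * aeval v (pderiv i F) = 0) (h1 : ∑ i, e1 i * aeval v (pderiv i F) = 0)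
    (h3 : ∑ i, e3 i * aeval v (pderiv i F) = 0) (h4 : ∑ i, e4 i * aeval v (pderiv i F) = 0) : v = 0 := by
  let M : Matrix (Fin 4) (Fin 4) ℂ := Matrix.of ![p, e1, e3, e4]
  have hu : IsUnit M := Matrix.linearIndependent_rows_iff_isUnit.1 hli
  have hinj := Matrix.mulVec_injective_of_isUnit hu
  have hz : M.mulVec (fun i => aeval v (pderiv i F)) = 0 := by
    funext k
    fin_cases k
    · exact h0
    · exact h1
    · exact h3
    · exact h4
  have hz' := hinj (hz.trans (Matrix.mulVec_zero M).symm)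
  apply hsm
  intro i
  rw [← coe_aeval_eq_eval]
  exact congrFun hz' i

theorem dpol_eval (F : MvPolynomial (Fin 4) ℂ) (p e1 v : Fin 4 → ℂ) (s : ℂ) :
    (dpol F p e1 v).eval s = ∑ i, v i * aeval (fun i => p i + s * e1 i) (pderiv i F) := by
  have := dpol_aeval F p e1 v s
  rw [Polynomial.coe_aeval_eq_eval] at this
  exact this

theorem dpol_base (F : MvPolynomial (Fin 4) ℂ) (hdeg : F.IsHomogeneous 4) (p e1 : Fin 4 → ℂ)
    (h : tay F p e1 = 0) : dpol F p e1 p = 0 := by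
  apply Polynomial.funext
  intro s
  have h1 := dpol_eval F p e1 e1 s
  rw [dpol_line F p e1 h] at h1
  rw [dpol_eval]
  have h2 := euler_zero F hdeg (fun i => p i + s * e1 i)
  have h3 := tay_aeval F p e1 s
  rw [h, map_zero] at h3
  change 0 = aeval (fun i => p i + s * e1 i) F at h3
  rw [← h3] at h2
  simp only [Fin.sum_univ_four, Polynomial.eval_zero] at *
  linear_combination h2 + s * h1

theorem dpol_inf (F : MvPolynomial (Fin 4) ℂ) (hdeg : F.IsHomogeneous 4) (p e1 v : Fin 4 → ℂ) (a : ℂ)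
    (h : dpol F p e1 v = Polynomial.C a) : ∑ i, v i * aeval e1 (pderiv i F) = 0 := by
  have key : Polynomial.X * dpol F e1 p v = Polynomial.X * (Polynomial.C a * Polynomial.X ^ 3) := by
    apply Polynomial.funext
    intro y
    by_cases hy : y = 0
    · simp [hy]
    · have h1 := dpol_eval F p e1 v y⁻¹
      rw [h, Polynomial.eval_C] at h1
      simp only [Polynomial.eval_mul, Polynomial.eval_X, Polynomial.eval_C, Polynomial.eval_pow]
      congr 1
      rw [dpol_eval, h1, Finset.sum_mul]
      apply Finset.sum_congr rfl
      intro i _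
      have h2 := hom_scale (pderiv i F) hdeg.pderiv (fun i => p i + y⁻¹ * e1 i) y
      have h3 : (fun i => y * (p i + y⁻¹ * e1 i)) = fun i => e1 i + y * p i := by
        funext i
        field_simp
        ring
      rw [h3] at h2
      rw [h2]
      ring
  have key2 := mul_left_cancel₀ Polynomial.X_ne_zero key
  have := dpol_eval F e1 p v 0
  rw [key2] at this
  simp only [zero_mul, add_zero] at this
  rw [← this]
  simp

theorem wr_ne (F : MvPolynomial (Fin 4) ℂ)
    (hdeg : F.IsHomogeneous 4)
    (hsm : ∀ v : Fin 4 → ℂ, (∀ i, eval v (pderiv i F) = 0) → v = 0)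
    (p e1 e3 e4 : Fin 4 → ℂ) (hli : LinearIndependent ℂ ![p, e1, e3, e4])
    (hline : tay F p e1 = 0) : wr F p e1 e3 e4 ≠ 0 := by
  intro hw
  have hp := dpol_base F hdeg p e1 hline
  have h1 := dpol_line F p e1 hline
  have hcop : IsCoprime (dpol F p e1 e3) (dpol F p e1 e4) := by
    rw [Polynomial.isCoprime_iff_aeval_ne_zero_of_isAlgClosed ℂ ℂ]
    intro s
    by_contra! hc
    obtain ⟨ha, hb⟩ := hc
    rw [Polynomial.coe_aeval_eq_eval, dpol_eval] at ha hb
    have hp' := dpol_eval F p e1 p s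
    have h1' := dpol_eval F p e1 e1 s
    rw [hp, Polynomial.eval_zero] at hp'
    rw [h1, Polynomial.eval_zero] at h1'
    have hv := kill F hsm p e1 e3 e4 hli _ hp'.symm h1'.symm ha hb
    have := Fintype.linearIndependent_iff.1 hli ![1, s, 0, 0] (by
      rw [Fin.sum_univ_four]
      funext i
      have := congrFun hv i
      simpa using this) 0
    simp at this
  have hw' : dpol F p e1 e4 * Polynomial.derivative (dpol F p e1 e3)
    = dpol F p e1 e3 * Polynomial.derivative (dpol F p e1 e4) := sub_eq_zero.1 hw
  have hB : Polynomial.derivative (dpol F p e1 e4) = 0 := by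
    rw [← Polynomial.dvd_derivative_iff]
    exact hcop.symm.dvd_of_dvd_mul_left ⟨_, hw'.symm⟩
  have hA : Polynomial.derivative (dpol F p e1 e3) = 0 := by
    rw [← Polynomial.dvd_derivative_iff]
    exact hcop.dvd_of_dvd_mul_left ⟨_, hw'⟩
  have hA' := Polynomial.eq_C_of_derivative_eq_zero hA
  have hB' := Polynomial.eq_C_of_derivative_eq_zero hB
  have := kill F hsm p e1 e3 e4 hli e1
    (dpol_inf F hdeg p e1 p 0 (by rw [hp, map_zero]))
    (dpol_inf F hdeg p e1 e1 0 (by rw [h1, map_zero]))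
    (dpol_inf F hdeg p e1 e3 _ hA') (dpol_inf F hdeg p e1 e4 _ hB')
  exact hli.ne_zero 1 this


theorem proj_root (P Q : Polynomial ℂ) (n : ℕ) (hn : n ≠ 0)
    (h : ∀ x, x ≠ 0 → P.eval x = x ^ n * Q.eval x⁻¹) : (∃ x, P.eval x = 0) ∨ Q.eval 0 = 0 := by
  by_cases hQ : Q.degree = 0
  · left
    have hQC := Polynomial.eq_C_of_degree_eq_zero hQ
    have key : Polynomial.X * P = Polynomial.X * (Polynomial.C (Q.coeff 0) * Polynomial.X ^ n) := by
      apply Polynomial.funext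
      intro y
      by_cases hy : y = 0
      · simp [hy]
      · have h1 := h y hy
        rw [hQC, Polynomial.eval_C] at h1
        simp only [Polynomial.eval_mul, Polynomial.eval_X, Polynomial.eval_C, Polynomial.eval_pow]
        rw [h1]
        ring
    have key2 := mul_left_cancel₀ Polynomial.X_ne_zero key
    refine ⟨0, ?_⟩
    rw [key2]
    simp [hn]
  · obtain ⟨y, hy⟩ := IsAlgClosed.exists_root Q hQ
    by_cases hy0 : y = 0
    · right
      rw [hy0] at hy; exact hy
    · left
      refine ⟨y⁻¹, ?_⟩
      rw [h _ (inv_ne_zero hy0), inv_inv, hy.eq_zero, mul_zero]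

theorem exists_pt (F : MvPolynomial (Fin 4) ℂ) (hdeg : F.IsHomogeneous 4) :
    ∃ p : Fin 4 → ℂ, p ≠ 0 ∧ aeval p F = 0 := by
  let a : Fin 4 → ℂ := ![1, 0, 0, 0]
  let b : Fin 4 → ℂ := ![0, 1, 0, 0]
  have ev : ∀ (a b : Fin 4 → ℂ) (x : ℂ), (tay F b a).eval x = aeval (fun i => b i + x * a i) F := by
    intro a b x
    have := tay_aeval F b a x
    rw [Polynomial.coe_aeval_eq_eval] at this
    exact this
  rcases proj_root (tay F b a) (tay F a b) 4 (by norm_num) (by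
    intro x hx
    rw [ev, ev, ← hom_scale F hdeg]
    congr 2
    funext i
    field_simp
    ring) with ⟨x, hx⟩ | h0
  · refine ⟨_, ?_, (ev _ _ _).symm.trans hx⟩
    intro h
    have := congrFun h 1
    simp [a, b] at this
  · refine ⟨_, ?_, (ev _ _ _).symm.trans h0⟩
    intro h
    have := congrFun h 0
    simp [a, b] at this

noncomputable def disc {R : Type} [CommRing R] [Algebra ℂ R] (F : MvPolynomial (Fin 4) ℂ)
    (P d : Fin 4 → R) : R :=
  (tay F P d).coeff 3 ^ 2 - 4 * (tay F P d).coeff 2 * (tay F P d).coeff 4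

theorem exists_disc (F : MvPolynomial (Fin 4) ℂ) (p d1 d2 : Fin 4 → ℂ) :
    (∃ x : ℂ, disc F p (fun i => d2 i + x * d1 i) = 0) ∨ disc F p d1 = 0 := by
  let T : (a b : Fin 4 → ℂ) → Polynomial ℂ := fun a b => disc F (fun i => Polynomial.C (p i))
    (fun i => Polynomial.C (b i) + Polynomial.X * Polynomial.C (a i))
  have ev : ∀ (a b : Fin 4 → ℂ) (x : ℂ), (T a b).eval x = disc F p (fun i => b i + x * a i) := by
    intro a b x
    rw [← Polynomial.coe_aeval_eq_eval]
    simp only [T, disc, map_sub, map_mul, map_pow, map_ofNat, tay_coeff_map]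
    simp only [map_add, map_mul, Polynomial.aeval_X, Polynomial.aeval_C]
    rfl
  rcases proj_root (T d1 d2) (T d2 d1) 6 (by norm_num) (by
    intro x hx
    rw [ev, ev]
    have : (fun i => d2 i + x * d1 i) = fun i => x * (d1 i + x⁻¹ * d2 i) := by
      funext i
      field_simp
      ring
    rw [this]
    simp only [disc, tay_scale]
    ring) with ⟨x, hx⟩ | h0
  · left
    exact ⟨x, (ev _ _ _).symm.trans hx⟩
  · right
    rw [ev] at h0
    simpa using h0

theorem li4 (ℓ : (Fin 4 → ℂ) →ₗ[ℂ] ℂ) (p a b c : Fin 4 → ℂ) (h : LinearIndependent ℂ ![p, a, b])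
    (hp : ℓ p = 0) (ha : ℓ a = 0) (hb : ℓ b = 0) (hc : ℓ c ≠ 0) :
    LinearIndependent ℂ ![p, a, c, b] := by
  rw [Fintype.linearIndependent_iff] at h ⊢
  intro g hg
  rw [Fin.sum_univ_four] at hg
  simp only [Matrix.cons_val] at hg
  have h2 := congrArg ℓ hg
  simp only [map_add, map_smul, hp, ha, hb, smul_eq_mul, mul_zero, zero_add, add_zero, map_zero] at h2
  have g2 : g 2 = 0 := (mul_eq_zero.1 h2).resolve_right hc
  have := h ![g 0, g 1, g 3] (by
    rw [Fin.sum_univ_three]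
    simp only [Matrix.cons_val]
    rw [g2] at hg
    simpa using hg)
  intro i
  fin_cases i
  · exact this 0
  · exact this 1
  · exact g2
  · exact this 2

theorem exists_frame (F : MvPolynomial (Fin 4) ℂ)
    (hdeg : F.IsHomogeneous 4)
    (hsm : ∀ v : Fin 4 → ℂ, (∀ i, eval v (pderiv i F) = 0) → v = 0) :
    ∃ p e1 e3 e4 : Fin 4 → ℂ, LinearIndependent ℂ ![p, e1, e3, e4] ∧ aeval p F = 0 ∧
      (tay F p e1).coeff 1 = 0 ∧ (tay F p e4).coeff 1 = 0 ∧ (tay F p e3).coeff 1 ≠ 0 ∧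
      disc F p e1 = 0 := by
  obtain ⟨p, hp0, hpF⟩ := exists_pt F hdeg
  let ℓ : (Fin 4 → ℂ) →ₗ[ℂ] ℂ := ∑ i, (aeval p (pderiv i F) : ℂ) • LinearMap.proj i
  have hℓ : ∀ v, ℓ v = (tay F p v).coeff 1 := by
    intro v
    rw [tay_coeff_one]
    simp [ℓ, mul_comm, LinearMap.sum_apply]
  have hℓ0 : ℓ ≠ 0 := by
    intro h
    apply hp0
    apply hsm
    intro i
    have := hℓ (Pi.single i 1)
    rw [h, tay_coeff_one] at this
    simp [Pi.single_apply] at this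
    rw [← coe_aeval_eq_eval]
    exact this.symm
  have hpk : ℓ p = 0 := by
    rw [hℓ, tay_coeff_one, euler_zero F hdeg, hpF, mul_zero]
  obtain ⟨e3, he3⟩ : ∃ v, ℓ v ≠ 0 := by
    by_contra! h
    exact hℓ0 (LinearMap.ext h)
  have hfr : Module.finrank ℂ (LinearMap.ker ℓ) = 3 := by
    have := Module.Dual.finrank_ker_add_one_of_ne_zero (f := ℓ) hℓ0
    rw [Module.finrank_fin_fun] at this
    omega
  let p' : LinearMap.ker ℓ := ⟨p, hpk⟩
  have l1 : LinearIndependent ℂ ![p'] := by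
    rw [Fintype.linearIndependent_iff]
    intro g hg i
    rw [Fin.sum_univ_one] at hg
    have hp1 : p' ≠ 0 := fun h => hp0 (congrArg Subtype.val h)
    have := (smul_eq_zero.1 hg).resolve_right hp1
    rwa [Subsingleton.elim i 0]
  obtain ⟨a, l2⟩ := exists_linearIndependent_cons_of_lt_finrank l1 (by omega)
  obtain ⟨b, l3⟩ := exists_linearIndependent_cons_of_lt_finrank l2 (by omega)
  have l4 : LinearIndependent ℂ ![(b : Fin 4 → ℂ), a, p] := by
    have := l3.map' (LinearMap.ker ℓ).subtype (Submodule.ker_subtype _)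
    have he : (LinearMap.ker ℓ).subtype ∘ (Fin.cons b (Fin.cons a ![p']) : Fin 3 → LinearMap.ker ℓ)
        = ![(b : Fin 4 → ℂ), a, p] := by
      funext i
      fin_cases i <;> rfl
    rw [← he]
    exact this
  rw [Fintype.linearIndependent_iff] at l4
  have l5 : ∀ x y z : ℂ, x • p + y • (a : Fin 4 → ℂ) + z • (b : Fin 4 → ℂ) = 0 → x = 0 ∧ y = 0 ∧ z = 0 := by
    intro x y z h
    have := l4 ![z, y, x] (by
      rw [Fin.sum_univ_three]
      simp only [Matrix.cons_val]
      rw [← h]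
      abel)
    exact ⟨this 2, this 1, this 0⟩
  have hak : ℓ a = 0 := a.2
  have hbk : ℓ b = 0 := b.2
  rcases exists_disc F p a b with ⟨x, hx⟩ | h0
  · have hv : (fun i => (b : Fin 4 → ℂ) i + x * (a : Fin 4 → ℂ) i) = (b : Fin 4 → ℂ) + x • (a : Fin 4 → ℂ) := by
      funext i; simp
    rw [hv] at hx
    have hk : ℓ ((b : Fin 4 → ℂ) + x • (a : Fin 4 → ℂ)) = 0 := by
      rw [map_add, map_smul, hak, hbk]; simp
    refine ⟨p, _, e3, a, li4 ℓ p _ a e3 ?_ hpk hk hak he3, hpF, (hℓ _).symm.trans hk,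
      (hℓ _).symm.trans hak, by rwa [← hℓ], hx⟩
    rw [Fintype.linearIndependent_iff]
    intro g hg
    rw [Fin.sum_univ_three] at hg
    simp only [Matrix.cons_val] at hg
    obtain ⟨h1, h2, h3⟩ := l5 (g 0) (g 1 * x + g 2) (g 1) (by
      rw [← hg]
      module)
    intro i
    fin_cases i
    · exact h1
    · exact h3
    · simpa [h3] using h2
  · refine ⟨p, a, e3, b, li4 ℓ p a b e3 ?_ hpk hak hbk he3, hpF, (hℓ _).symm.trans hak,
      (hℓ _).symm.trans hbk, by rwa [← hℓ], h0⟩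
    rw [Fintype.linearIndependent_iff]
    intro g hg
    rw [Fin.sum_univ_three] at hg
    simp only [Matrix.cons_val] at hg
    obtain ⟨h1, h2, h3⟩ := l5 (g 0) (g 1) (g 2) hg
    intro i
    fin_cases i
    · exact h1
    · exact h2
    · exact h3

theorem exists_ef (a b c : ℂ) (h : b ^ 2 - 4 * a * c = 0) :
    ∃ e f : ℂ, a = e ^ 2 ∧ b = 2 * e * f ∧ c = f ^ 2 := by
  obtain ⟨e, he⟩ := IsAlgClosed.exists_pow_nat_eq a two_pos
  obtain ⟨f, hf⟩ := IsAlgClosed.exists_pow_nat_eq c two_pos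
  have h1 : (b - 2 * e * f) * (b + 2 * e * f) = 0 := by
    rw [← he, ← hf] at h
    linear_combination h
  rcases mul_eq_zero.1 h1 with h1 | h1
  · exact ⟨e, f, he.symm, by linear_combination h1, hf.symm⟩
  · exact ⟨e, -f, he.symm, by linear_combination h1, by rw [← hf]; ring⟩

theorem main (F : MvPolynomial (Fin 4) ℂ)
    (hdeg : F.IsHomogeneous 4)
    (hsm : ∀ v : Fin 4 → ℂ, (∀ i, eval v (pderiv i F) = 0) → v = 0) :
    ∃ f : FractionRing (MvPolynomial (Fin 4) ℂ ⧸
        (Ideal.span {X 3 ^ 2 - rename Fin.castSucc (dehom F)})) →ₐ[ℂ] CRatFunc 3,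
      Function.Injective f := by
  obtain ⟨p, e1, e3, e4, hli, hp, h1, hd4, hd3, hdisc⟩ := exists_frame F hdeg hsm
  have h0 : (tay F p e1).coeff 0 = 0 := by rw [tay_coeff_zero, hp]
  obtain ⟨e, f, h2, h3, h4⟩ := exists_ef _ _ _ hdisc
  by_cases hef : e = 0 ∧ f = 0
  · obtain ⟨rfl, rfl⟩ := hef
    have hline : tay F p e1 = 0 := by
      ext k
      rcases lt_or_ge 4 k with hk | hk
      · rw [Polynomial.coeff_zero]
        exact Polynomial.coeff_eq_zero_of_natDegree_lt (lt_of_le_of_lt (tay_natDegree F hdeg p e1) hk)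
      · interval_cases k
        · simpa using h0
        · simpa using h1
        · simpa using h2
        · simpa using h3
        · simpa using h4
    exact caseI F hdeg hsm p e1 e3 e4 hli _ hd3 hline rfl hd4 (wr_ne F hdeg hsm p e1 e3 e4 hli hline)
  · exact caseII F hdeg hsm p e1 e3 e4 hli e f _ hef hd3 h0 h1 h2 h3 h4 rfl hd4


end QDS

/-- **Unirationality of smooth quartic double solids, field version.** If `F ∈ ℂ[X₀,…,X₃]`
is homogeneous of degree 4 and the only common zero of its partial derivatives is the
origin, then the field of fractions of `ℂ[x₁,x₂,x₃,w]/(w² − F(1,x₁,x₂,x₃))` admits a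
`ℂ`-algebra embedding into `ℂ(t₁,t₂,t₃)`. -/
theorem quartic_double_solid_unirational (F : MvPolynomial (Fin 4) ℂ)
    (hdeg : F.IsHomogeneous 4)
    (hsm : ∀ v : Fin 4 → ℂ, (∀ i, eval v (pderiv i F) = 0) → v = 0) :
    ∃ f : FractionRing (MvPolynomial (Fin 4) ℂ ⧸
        (Ideal.span {X 3 ^ 2 - rename Fin.castSucc (dehom F)})) →ₐ[ℂ] CRatFunc 3,
      Function.Injective f := by
  exact QDS.main F hdeg hsm
end
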